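/- arXiv:2210.13878 — 4 statements merged into one kernel-verified Lean document; each statement's English description precedes it below -/
import Mathlib

section
/- For all i, j, k, l ∈ {1,...,n+1}, the operators ρ satisfy the gl(n+1) commutation relations ρ_{i,j}∘ρ_{k,l} − ρ_{k,l}∘ρ_{i,j} = δ_{j,k}·ρ_{i,l} − δ_{l,i}·ρ_{k,j} as linear operators on R; that is, the assignment E_{i,j} ↦ ρ_{i,j} defines a representation of the Lie algebra gl(n+1,ℂ) on the polynomial ring R. -/
open MvPolynomial Finset

noncomputable section

/-- The polynomial ring `R = ℂ[x_{i,j}]` (we use variables indexed by pairs of naturals;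
only those with `1 ≤ j ≤ i ≤ n` are relevant). -/
abbrev Rpoly : Type := MvPolynomial (ℕ × ℕ) ℂ

/-- The extended variable `x_{i,j}`, with the conventions `x_{i,i+1} = -1` and
`x_{i,j} = 0` for `j > i + 1`. -/
def Xv (i j : ℕ) : Rpoly :=
  if j ≤ i then MvPolynomial.X (i, j) else if j = i + 1 then -1 else 0

/-- `d_{i,j}(Θ)`: the determinant of the `(i-j+1) × (i-j+1)` matrix whose `(a,b)` entry
is `x_{j+a-1, θ_b}` (rows indexed by `j, j+1, ..., i`). -/
def dPoly (i j : ℕ) (Θ : Fin (i - j + 1) → ℕ) : Rpoly :=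
  Matrix.det (Matrix.of fun a b : Fin (i - j + 1) => Xv (j + a.1) (Θ b))

/-- `D_{i,j}(s) = d_{i,j}(s, j+1, j+2, ..., i)`. -/
def DPoly (i j s : ℕ) : Rpoly :=
  dPoly i j (fun b => if b.1 = 0 then s else j + b.1)

/-- The partial derivative `∂_{x_{p}}` as a `ℂ`-linear operator on `R`. -/
def pd (p : ℕ × ℕ) : Module.End ℂ Rpoly := (MvPolynomial.pderiv p).toLinearMap

/-- Multiplication by a fixed polynomial, as a `ℂ`-linear operator on `R`. -/
def mulOp (a : Rpoly) : Module.End ℂ Rpoly := LinearMap.mulLeft ℂ a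

/-- The operators `ρ_{i,j}` of the full projective oscillator representation of
`gl(n+1)` on `R`, for a constant `c ∈ ℂ` and weights `k_1, ..., k_n ∈ ℕ`. -/
def ρ (n : ℕ) (c : ℂ) (k : ℕ → ℕ) (i j : ℕ) : Module.End ℂ Rpoly :=
  if i = j then
    (c - ∑ r ∈ Finset.Icc i n, (k (n - r + 1) : ℂ)) • (1 : Module.End ℂ Rpoly)
      + ∑ r ∈ Finset.Icc i n, mulOp (Xv r i) ∘ₗ pd (r, i)
      - ∑ s ∈ Finset.Icc 1 (i - 1), mulOp (Xv (i - 1) s) ∘ₗ pd (i - 1, s)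
  else if j < i then
    - pd (i - 1, j) + ∑ r ∈ Finset.Icc i n, mulOp (Xv r i) ∘ₗ pd (r, j)
  else
    ∑ r ∈ Finset.Icc j n, mulOp (Xv r i) ∘ₗ pd (r, j)
      + ∑ s ∈ Finset.Icc (i - 1) (j - 1), ∑ t ∈ Finset.Icc 1 s,
          mulOp (DPoly (j - 1) s t * Xv s i) ∘ₗ pd (s, t)
      - mulOp (∑ s ∈ Finset.Icc i (j - 1), (k (n + 1 - s) : ℂ) • DPoly (j - 1) s i)

/-- The full coordinate matrix with rows `x_{r,·}`, `0 ≤ r ≤ n`, and columns shifted to start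
at `0`; it is lower triangular with diagonal `-1`. -/
def coordMatrix (n : ℕ) : Matrix (Fin (n + 1)) (Fin (n + 1)) Rpoly :=
  Matrix.of fun r s => Xv r (s + 1)

lemma Xv_succ_self (r : ℕ) : Xv r (r + 1) = -1 := by simp [Xv]

lemma Xv_of_lt {r s : ℕ} (h : r + 1 < s) : Xv r s = 0 := by
  simp [Xv, show ¬ s ≤ r by omega, show s ≠ r + 1 by omega]

lemma Xv_of_le {r s : ℕ} (h : s ≤ r) : Xv r s = X (r, s) := by simp [Xv, h]

lemma coordMatrix_isLowerTriangular (n : ℕ) : (coordMatrix n).IsLowerTriangular := by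
  intro r s h
  exact Xv_of_lt (Nat.succ_lt_succ h)

lemma isUnit_det_coordMatrix (n : ℕ) : IsUnit (coordMatrix n).det := by
  rw [Matrix.det_of_isLowerTriangular _ (coordMatrix_isLowerTriangular n)]
  simp [coordMatrix, Xv_succ_self]

/-- The strictly lower triangular part of a square matrix. -/
def strictLower {m : ℕ} {S : Type*} [Zero S] (A : Matrix (Fin m) (Fin m) S) :
    Matrix (Fin m) (Fin m) S :=
  Matrix.of fun r s => if s < r then A r s else 0

section StrictLower

variable {m : ℕ} {S : Type*} [CommRing S] (A B : Matrix (Fin m) (Fin m) S)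

lemma strictLower_add : strictLower (A + B) = strictLower A + strictLower B := by
  ext r s; simp only [strictLower, Matrix.of_apply, Matrix.add_apply]; split_ifs <;> simp

lemma strictLower_sub : strictLower (A - B) = strictLower A - strictLower B := by
  ext r s; simp only [strictLower, Matrix.of_apply, Matrix.sub_apply]; split_ifs <;> simp

lemma strictLower_strictLower_mul_strictLower :
    strictLower (strictLower A * strictLower B) = strictLower A * strictLower B := by
  ext r s
  simp only [strictLower, Matrix.of_apply]
  split_ifs with h
  · rfl
  · rw [Matrix.mul_apply, Finset.sum_eq_zero]
    intro q _
    simp only [Matrix.of_apply]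
    split_ifs <;> first | omega | simp

lemma strictLower_mul_diag (r : Fin m) : (strictLower A * strictLower B) r r = 0 := by
  rw [← strictLower_strictLower_mul_strictLower]; simp [strictLower]

lemma sub_strictLower_apply (r s : Fin m) :
    (A - strictLower A) r s = if s < r then 0 else A r s := by
  simp only [strictLower, Matrix.of_apply, Matrix.sub_apply]; split_ifs <;> simp

lemma strictLower_upper_mul_upper :
    strictLower ((A - strictLower A) * (B - strictLower B)) = 0 := by
  ext r s
  simp only [strictLower, Matrix.of_apply, Matrix.zero_apply]
  split_ifs with h
  · rw [Matrix.mul_apply, Finset.sum_eq_zero]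
    intro q _
    have h1 := sub_strictLower_apply A r q
    have h2 := sub_strictLower_apply B q s
    simp only [strictLower] at h1 h2
    rw [h1, h2]
    split_ifs <;> first | omega | simp
  · rfl

lemma upper_mul_upper_diag (r : Fin m) :
    ((A - strictLower A) * (B - strictLower B)) r r = A r r * B r r := by
  rw [Matrix.mul_apply, Finset.sum_eq_single r]
  · simp only [sub_strictLower_apply, lt_irrefl, if_false]
  · intro q _ hq
    rw [sub_strictLower_apply, sub_strictLower_apply]
    split_ifs <;> first | omega | simp
  · simp

/-- Projecting brackets to the strictly lower triangular part: the subalgebras of strictly lower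
and of upper triangular matrices are complementary. -/
lemma strictLower_bracket :
    strictLower (strictLower A * B - B * strictLower A)
        - strictLower (strictLower B * A - A * strictLower B)
        - (strictLower A * strictLower B - strictLower B * strictLower A)
      = strictLower (A * B - B * A) := by
  have h1 := strictLower_strictLower_mul_strictLower A B
  have h2 := strictLower_strictLower_mul_strictLower B A
  have h3 := strictLower_upper_mul_upper A B
  have h4 := strictLower_upper_mul_upper B A
  rw [← h1, ← h2]
  have e : A * B - B * A = (strictLower A * B - B * strictLower A)
      - (strictLower B * A - A * strictLower B)
      - (strictLower A * strictLower B - strictLower B * strictLower A)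
      + ((A - strictLower A) * (B - strictLower B)
        - (B - strictLower B) * (A - strictLower A)) := by noncomm_ring
  rw [e, strictLower_add, strictLower_sub _ (_ * (A - _)), h3, h4]
  simp only [strictLower_sub, sub_zero, add_zero]

lemma strictLower_bracket_mul (X : Matrix (Fin m) (Fin m) S) :
    (strictLower (strictLower A * B - B * strictLower A) * X
        + strictLower B * (strictLower A * X))
      - (strictLower (strictLower B * A - A * strictLower B) * X
        + strictLower A * (strictLower B * X))
      = strictLower (A * B - B * A) * X := by
  rw [← strictLower_bracket A B]
  noncomm_ring

lemma diag_bracket (r : Fin m) :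
    (strictLower A * B - B * strictLower A) r r - (strictLower B * A - A * strictLower B) r r
      = (A * B - B * A) r r := by
  have h1 := strictLower_mul_diag A B r
  have h2 := strictLower_mul_diag B A r
  have h3 := upper_mul_upper_diag A B r
  have h4 := upper_mul_upper_diag B A r
  simp only [sub_mul, mul_sub, Matrix.sub_apply] at *
  linear_combination h1 - h2 - h3 + h4

end StrictLower

section DerivationMap

variable {R S : Type*} [CommRing R] [CommRing S] [Algebra R S] (D : Derivation R S S)

lemma map_derivation_mul {m : ℕ} (A B : Matrix (Fin m) (Fin m) S) :
    (A * B).map D = A.map D * B + A * B.map D := by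
  ext r s
  simp only [Matrix.map_apply, Matrix.mul_apply, Matrix.add_apply, map_sum, Derivation.leibniz,
    smul_eq_mul, Finset.sum_add_distrib]
  rw [add_comm]
  simp only [mul_comm]

lemma map_derivation_one {m : ℕ} : (1 : Matrix (Fin m) (Fin m) S).map D = 0 := by
  ext r s
  simp only [Matrix.map_apply, Matrix.one_apply, Matrix.zero_apply]
  split_ifs <;> simp

lemma map_derivation_inv {m : ℕ} {A : Matrix (Fin m) (Fin m) S} (hA : IsUnit A.det) :
    A⁻¹.map D = -(A⁻¹ * A.map D * A⁻¹) := by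
  have h := map_derivation_mul D A⁻¹ A
  rw [Matrix.nonsing_inv_mul _ hA, map_derivation_one] at h
  have h2 : A⁻¹.map D * A * A⁻¹ = A⁻¹.map D := by
    rw [mul_assoc, Matrix.mul_nonsing_inv _ hA, mul_one]
  rw [← h2, ← neg_mul, ← eq_neg_of_add_eq_zero_left h.symm]

/-- If `D X = Y X` and `D A = 0` then `D (X A X⁻¹) = [Y, X A X⁻¹]`. -/
lemma map_derivation_conj {m : ℕ} {X A Y : Matrix (Fin m) (Fin m) S} (hX : IsUnit X.det)
    (h : X.map D = Y * X) (hA : A.map D = 0) :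
    (X * A * X⁻¹).map D = Y * (X * A * X⁻¹) - X * A * X⁻¹ * Y := by
  rw [map_derivation_mul, map_derivation_mul, hA, map_derivation_inv _ hX, h, ← mul_assoc X⁻¹ Y,
    mul_assoc (X⁻¹ * Y) X, Matrix.mul_nonsing_inv _ hX]
  noncomm_ring

lemma map_derivation_strictLower {m : ℕ} (A : Matrix (Fin m) (Fin m) S) :
    (strictLower A).map D = strictLower (A.map D) := by
  ext r s
  simp only [strictLower, Matrix.map_apply, Matrix.of_apply]
  split_ifs <;> simp

end DerivationMap

section Operators

variable {n : ℕ}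

/-- The conjugate `X A X⁻¹` of a constant matrix by the coordinate matrix. -/
def coordConj (A : Matrix (Fin (n + 1)) (Fin (n + 1)) ℂ) :
    Matrix (Fin (n + 1)) (Fin (n + 1)) Rpoly :=
  coordMatrix n * A.map C * (coordMatrix n)⁻¹

lemma coordConj_sub (A B : Matrix (Fin (n + 1)) (Fin (n + 1)) ℂ) :
    coordConj (A - B) = coordConj A - coordConj B := by
  simp only [coordConj, ← RingHom.mapMatrix_apply, map_sub]
  noncomm_ring

lemma coordConj_mul (A B : Matrix (Fin (n + 1)) (Fin (n + 1)) ℂ) :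
    coordConj (A * B) = coordConj A * coordConj B := by
  simp only [coordConj, ← RingHom.mapMatrix_apply, map_mul, mul_assoc]
  rw [← mul_assoc (coordMatrix n)⁻¹ (coordMatrix n),
    Matrix.nonsing_inv_mul _ (isUnit_det_coordMatrix n), one_mul]

/-- The matrix whose entries are the components of the vector field attached to `A`. -/
def fieldMatrix (A : Matrix (Fin (n + 1)) (Fin (n + 1)) ℂ) :
    Matrix (Fin (n + 1)) (Fin (n + 1)) Rpoly :=
  strictLower (coordConj A) * coordMatrix n

/-- The vector field attached to `A`: the infinitesimal right action of `A` on the coordinate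
matrix, corrected by a left upper triangular factor. -/
def vectorField (A : Matrix (Fin (n + 1)) (Fin (n + 1)) ℂ) : Derivation ℂ Rpoly Rpoly :=
  mkDerivation ℂ fun p =>
    if h : p.1 < n + 1 ∧ p.2 - 1 < n + 1 ∧ p.2 ≤ p.1 ∧ p.2 ≠ 0 then
      fieldMatrix A ⟨p.1, h.1⟩ ⟨p.2 - 1, h.2.1⟩ else 0

lemma fieldMatrix_apply (A : Matrix (Fin (n + 1)) (Fin (n + 1)) ℂ) (r s : Fin (n + 1)) :
    fieldMatrix A r s
      = ∑ q, if q < r then coordConj A r q * Xv q (s + 1) else 0 := by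
  simp only [fieldMatrix, Matrix.mul_apply, strictLower, Matrix.of_apply, coordMatrix, ite_mul,
    zero_mul]

lemma fieldMatrix_of_le (A : Matrix (Fin (n + 1)) (Fin (n + 1)) ℂ) {r s : Fin (n + 1)}
    (h : r ≤ s) : fieldMatrix A r s = 0 := by
  rw [fieldMatrix_apply, Finset.sum_eq_zero]
  intro q _
  split_ifs with h1
  · rw [Xv_of_lt (by omega), mul_zero]
  · rfl

lemma fieldMatrix_sub (A B : Matrix (Fin (n + 1)) (Fin (n + 1)) ℂ) :
    fieldMatrix (A - B) = fieldMatrix A - fieldMatrix B := by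
  simp only [fieldMatrix, coordConj_sub, strictLower_sub, sub_mul]

lemma vectorField_sub (A B : Matrix (Fin (n + 1)) (Fin (n + 1)) ℂ) :
    vectorField (A - B) = vectorField A - vectorField B := by
  refine derivation_ext fun p => ?_
  rw [Derivation.sub_apply]
  simp only [vectorField, mkDerivation_X, fieldMatrix_sub]
  split_ifs <;> simp

lemma map_vectorField_coordMatrix (A : Matrix (Fin (n + 1)) (Fin (n + 1)) ℂ) :
    (coordMatrix n).map (vectorField A) = strictLower (coordConj A) * coordMatrix n := by
  refine Matrix.ext fun r s => ?_
  change vectorField A (Xv r (s + 1)) = fieldMatrix A r s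
  by_cases h : s < r
  · rw [Xv_of_le (by omega), vectorField, mkDerivation_X, dif_pos (by simp; omega)]
    simp
  · rw [fieldMatrix_of_le A (not_lt.mp h), Xv, if_neg (by omega)]
    split_ifs <;> simp

lemma map_vectorField_coordConj (A B : Matrix (Fin (n + 1)) (Fin (n + 1)) ℂ) :
    (coordConj B).map (vectorField A)
      = strictLower (coordConj A) * coordConj B - coordConj B * strictLower (coordConj A) := by
  have hC : (B.map C).map (vectorField A) = 0 := by
    refine Matrix.ext fun r s => ?_
    simp [derivation_C]
  exact map_derivation_conj _ (isUnit_det_coordMatrix n) (map_vectorField_coordMatrix A) hC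

lemma map_vectorField_fieldMatrix (A B : Matrix (Fin (n + 1)) (Fin (n + 1)) ℂ) :
    (fieldMatrix B).map (vectorField A)
      = strictLower (strictLower (coordConj A) * coordConj B
          - coordConj B * strictLower (coordConj A)) * coordMatrix n
        + strictLower (coordConj B) * (strictLower (coordConj A) * coordMatrix n) := by
  rw [fieldMatrix, map_derivation_mul, map_derivation_strictLower, map_vectorField_coordConj,
    map_vectorField_coordMatrix]

lemma vectorField_bracket (A B : Matrix (Fin (n + 1)) (Fin (n + 1)) ℂ) :
    ⁅vectorField A, vectorField B⁆ = vectorField (A * B - B * A) := by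
  have key : (fieldMatrix B).map (vectorField A) - (fieldMatrix A).map (vectorField B)
      = fieldMatrix (A * B - B * A) := by
    rw [map_vectorField_fieldMatrix, map_vectorField_fieldMatrix, fieldMatrix, coordConj_sub,
      coordConj_mul, coordConj_mul]
    exact strictLower_bracket_mul _ _ _
  refine derivation_ext fun p => ?_
  rw [Derivation.commutator_apply]
  have hX (M : Matrix (Fin (n + 1)) (Fin (n + 1)) ℂ) := mkDerivation_X (R := ℂ) (fun p : ℕ × ℕ =>
    if h : p.1 < n + 1 ∧ p.2 - 1 < n + 1 ∧ p.2 ≤ p.1 ∧ p.2 ≠ 0 then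
      fieldMatrix M ⟨p.1, h.1⟩ ⟨p.2 - 1, h.2.1⟩ else 0) p
  change ∀ M, vectorField M (X p) = _ at hX
  rw [hX, hX, hX]
  split_ifs with h
  · rw [← key]; rfl
  · simp

/-- The multiplication part of the operator attached to `A`, for a diagonal character `w`. -/
def character (w : Fin (n + 1) → ℂ) (A : Matrix (Fin (n + 1)) (Fin (n + 1)) ℂ) : Rpoly :=
  ∑ r, w r • coordConj A r r

lemma character_sub (w : Fin (n + 1) → ℂ) (A B : Matrix (Fin (n + 1)) (Fin (n + 1)) ℂ) :
    character w (A - B) = character w A - character w B := by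
  simp only [character, coordConj_sub, Matrix.sub_apply, smul_sub, Finset.sum_sub_distrib]

lemma vectorField_character_sub (w : Fin (n + 1) → ℂ)
    (A B : Matrix (Fin (n + 1)) (Fin (n + 1)) ℂ) :
    vectorField A (character w B) - vectorField B (character w A)
      = character w (A * B - B * A) := by
  have h (A B : Matrix (Fin (n + 1)) (Fin (n + 1)) ℂ) (r : Fin (n + 1)) :
      vectorField A (coordConj B r r)
        = (strictLower (coordConj A) * coordConj B
            - coordConj B * strictLower (coordConj A)) r r := by
    rw [← map_vectorField_coordConj]; rfl
  simp only [character, map_sum, Derivation.map_smul, h, ← Finset.sum_sub_distrib, ← smul_sub,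
    diag_bracket, coordConj_sub, coordConj_mul]

/-- The first order operator attached to `A`, for a diagonal character `w`. -/
def actionOp (w : Fin (n + 1) → ℂ) (A : Matrix (Fin (n + 1)) (Fin (n + 1)) ℂ) :
    Module.End ℂ Rpoly :=
  (vectorField A).toLinearMap + mulOp (character w A)

lemma actionOp_sub (w : Fin (n + 1) → ℂ) (A B : Matrix (Fin (n + 1)) (Fin (n + 1)) ℂ) :
    actionOp w (A - B) = actionOp w A - actionOp w B := by
  refine LinearMap.ext fun p => ?_
  simp only [actionOp, vectorField_sub, character_sub, mulOp, LinearMap.sub_apply,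
    LinearMap.add_apply, LinearMap.mulLeft_apply, Derivation.coeFn_coe, Derivation.sub_apply]
  ring

lemma actionOp_zero (w : Fin (n + 1) → ℂ) : actionOp w 0 = 0 := by
  simpa using actionOp_sub w 0 0

lemma actionOp_bracket (w : Fin (n + 1) → ℂ) (A B : Matrix (Fin (n + 1)) (Fin (n + 1)) ℂ) :
    actionOp w A * actionOp w B - actionOp w B * actionOp w A = actionOp w (A * B - B * A) := by
  refine LinearMap.ext fun p => ?_
  have h := congrArg (fun D => D p) (vectorField_bracket A B)
  simp only [Derivation.commutator_apply] at h
  simp only [actionOp, mulOp, LinearMap.sub_apply, Module.End.mul_apply, LinearMap.add_apply,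
    LinearMap.mulLeft_apply, map_add, ← h, ← vectorField_character_sub,
    Derivation.coeFn_coe, Derivation.leibniz, smul_eq_mul]
  ring

end Operators

section Matching

variable {n : ℕ}

/-- The entries of the inverse of the coordinate matrix, extended by zero to all naturals. -/
def invEntry (n j q : ℕ) : Rpoly :=
  if h : j < n + 1 ∧ q < n + 1 then (coordMatrix n)⁻¹ ⟨j, h.1⟩ ⟨q, h.2⟩ else 0

lemma invEntry_of_lt {j q : ℕ} (h : j < q) : invEntry n j q = 0 := by
  rw [invEntry]
  split_ifs with h1
  · have := Matrix.invertibleOfIsUnitDet _ (isUnit_det_coordMatrix n)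
    exact Matrix.blockTriangular_inv_of_blockTriangular (coordMatrix_isLowerTriangular n)
      (OrderDual.toDual_lt_toDual.mpr (Fin.mk_lt_mk.mpr h))
  · rfl

lemma coordConj_single (i j r q : Fin (n + 1)) :
    coordConj (Matrix.single i j 1) r q = Xv r (i + 1) * invEntry n j q := by
  simp only [coordConj, Matrix.map_single _ _ _ C, map_one]
  rw [Matrix.mul_apply, Finset.sum_eq_single j]
  · rw [Matrix.mul_single_apply_same, invEntry, dif_pos ⟨j.2, q.2⟩, mul_one]
    rfl
  · intro b _ hb
    rw [Matrix.mul_single_apply_of_ne _ _ _ _ _ hb, zero_mul]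
  · simp

lemma sum_invEntry_mul_Xv {j t : ℕ} (hj : j ≤ n) (ht : t ≤ n) :
    ∑ q ∈ range (n + 1), invEntry n j q * Xv q (t + 1) = if j = t then 1 else 0 := by
  have h := congrFun (congrFun (Matrix.nonsing_inv_mul _ (isUnit_det_coordMatrix n))
    ⟨j, Nat.lt_succ_of_le hj⟩) ⟨t, Nat.lt_succ_of_le ht⟩
  rw [Matrix.mul_apply, Matrix.one_apply] at h
  simp only [Fin.mk.injEq] at h
  rw [← h, ← Fin.sum_univ_eq_sum_range (fun q => invEntry n j q * Xv q (t + 1))]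
  refine Finset.sum_congr rfl fun q _ => ?_
  rw [invEntry, dif_pos ⟨Nat.lt_succ_of_le hj, q.2⟩]
  rfl

lemma sum_Icc_invEntry_mul_Xv {s j t : ℕ} (hj : j ≤ n) (hst : s ≤ t) (ht : t ≤ n) :
    ∑ q ∈ Icc s j, invEntry n j q * Xv q (t + 1) = if j = t then 1 else 0 := by
  rw [← sum_invEntry_mul_Xv hj ht]
  refine Finset.sum_subset (fun q hq => ?_) fun q _ hq => ?_
  · simp only [Finset.mem_Icc, Finset.mem_range] at *; omega
  · simp only [Finset.mem_Icc, not_and_or, not_le] at hq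
    rcases hq with hq | hq
    · rw [Xv_of_lt (by omega), mul_zero]
    · rw [invEntry_of_lt hq, zero_mul]

lemma invEntry_self {j : ℕ} (hj : j ≤ n) : invEntry n j j = -1 := by
  have h := sum_Icc_invEntry_mul_Xv (s := j) hj le_rfl hj
  rw [Finset.Icc_self, Finset.sum_singleton, Xv_succ_self, if_pos rfl] at h
  linear_combination -h

/-- Cramer's rule: the minors `D_{j,s}(t)` are partial sums of a row of the inverse matrix against
a column of the coordinate matrix. -/
lemma DPoly_eq_neg_sum {s j : ℕ} (hs : s ≤ j) (hj : j ≤ n) (t : ℕ) :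
    DPoly j s t = -∑ q ∈ Icc s j, invEntry n j q * Xv q t := by
  set M : Matrix (Fin (j - s + 1)) (Fin (j - s + 1)) Rpoly :=
    Matrix.of fun a b => Xv (s + a.1) (if b.1 = 0 then t else s + b.1) with hM
  set v : Fin (j - s + 1) → Rpoly := fun a => -invEntry n j (s + a) with hv
  have hsum (u : ℕ) : ∑ a : Fin (j - s + 1), v a * Xv (s + a) u
      = -∑ q ∈ Icc s j, invEntry n j q * Xv q u := by
    rw [← Finset.Ico_succ_right_eq_Icc, Finset.sum_Ico_eq_sum_range,
      ← Fin.sum_univ_eq_sum_range (fun q => invEntry n j (s + q) * Xv (s + q) u),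
      ← Finset.sum_neg_distrib, Order.succ_eq_add_one, show j + 1 - s = j - s + 1 by omega]
    exact Finset.sum_congr rfl fun a _ => neg_mul _ _
  have hvM : Matrix.vecMul v M
      = Pi.single 0 (-∑ q ∈ Icc s j, invEntry n j q * Xv q t) := by
    ext1 b
    simp only [Matrix.vecMul, dotProduct, hM, Matrix.of_apply]
    rw [hsum]
    rcases eq_or_ne b 0 with rfl | hb
    · simp
    · have hb' : b.1 ≠ 0 := fun h => hb (Fin.ext h)
      have hb2 := b.2
      rw [Pi.single_eq_of_ne hb, if_neg hb', show s + b.1 = s + b.1 - 1 + 1 by omega,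
        sum_Icc_invEntry_mul_Xv hj (by omega) (by omega), if_neg (by omega), neg_zero]
  have hadj : M.adjugate 0 (Fin.last _) = 1 := by
    rw [Matrix.adjugate_fin_succ_eq_det_submatrix, Matrix.det_of_isLowerTriangular]
    · simp only [Matrix.submatrix_apply, Fin.succAbove_last, Fin.succAbove_zero, hM,
        Matrix.of_apply, Fin.val_castSucc, Fin.val_succ, Nat.succ_ne_zero, if_false,
        ← add_assoc, Xv_succ_self]
      simp [← mul_pow]
    · intro a b hab
      have hab' : a < b := hab
      simp only [Matrix.submatrix_apply, Fin.succAbove_last, Fin.succAbove_zero, hM,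
        Matrix.of_apply, Fin.val_castSucc, Fin.val_succ, Nat.succ_ne_zero, if_false]
      exact Xv_of_lt (by omega)
  have hdet := congrFun (congrArg (fun w => Matrix.vecMul w M.adjugate) hvM) (Fin.last _)
  simp only [Matrix.vecMul_vecMul, Matrix.mul_adjugate, Matrix.single_vecMul] at hdet
  have hlast : v (Fin.last _) = 1 := by
    simp [hv, Nat.add_sub_cancel' hs, invEntry_self hj]
  simp only [Matrix.vecMul_smul, Matrix.vecMul_one, Pi.smul_apply, smul_eq_mul, hlast, mul_one,
    Matrix.row_apply, hadj] at hdet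
  exact hdet

lemma DPoly_self (j t : ℕ) : DPoly j j t = Xv j t := by
  rw [DPoly_eq_neg_sum le_rfl le_rfl, Finset.Icc_self, Finset.sum_singleton, invEntry_self le_rfl]
  ring

lemma sum_range_invEntry_mul_Xv {r s j : ℕ} (hj : j ≤ n) (hsr : s < r) (hr : r ≤ n) :
    ∑ q ∈ range r, invEntry n j q * Xv q (s + 1)
      = if r ≤ j then DPoly j r (s + 1) else if j = s then 1 else 0 := by
  have h := sum_invEntry_mul_Xv hj (hsr.le.trans hr)
  rw [← Finset.sum_range_add_sum_Ico _ (show r ≤ n + 1 by omega)] at h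
  split_ifs with hrj
  · rw [if_neg (by omega)] at h
    rw [DPoly_eq_neg_sum hrj hj, eq_neg_of_add_eq_zero_left h]
    congr 1
    symm
    refine Finset.sum_subset (fun q hq => ?_) fun q hq hq' => ?_
    · simp only [Finset.mem_Icc, Finset.mem_Ico] at *; omega
    · simp only [Finset.mem_Icc, Finset.mem_Ico] at hq hq'
      rw [invEntry_of_lt (by omega), zero_mul]
  all_goals
    rw [Finset.sum_eq_zero (s := Finset.Ico _ _), add_zero] at h
    · simp_all
    · intro q hq
      rw [Finset.mem_Ico] at hq
      rw [invEntry_of_lt (by omega), zero_mul]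

lemma fieldMatrix_single (i j : Fin (n + 1)) {r s : Fin (n + 1)} (h : s < r) :
    fieldMatrix (Matrix.single i j 1) r s
      = Xv r (i + 1) *
        if r.1 ≤ j.1 then DPoly j r (s + 1) else if j.1 = s.1 then 1 else 0 := by
  have hf (q : Fin (n + 1)) :
      (if q < r then coordConj (Matrix.single i j 1) r q * Xv q (s + 1) else 0)
        = (fun q : ℕ => if q < r.1 then
            Xv r (i + 1) * (invEntry n j q * Xv q (s + 1)) else 0) q := by
    simp only [coordConj_single, Fin.lt_def, mul_assoc]
  rw [fieldMatrix_apply, Finset.sum_congr rfl fun q _ => hf q, Fin.sum_univ_eq_sum_range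
      (fun q : ℕ => if q < r.1 then Xv r (i + 1) * (invEntry n j q * Xv q (s + 1)) else 0),
    ← sum_range_invEntry_mul_Xv (n := n) (by omega) h (by omega), Finset.mul_sum,
    ← Finset.sum_filter]
  refine Finset.sum_congr ?_ fun _ _ => rfl
  ext q
  simp only [Finset.mem_filter, Finset.mem_range]
  omega

lemma vectorField_single_X (i j : Fin (n + 1)) (r s : ℕ) :
    vectorField (Matrix.single i j 1) (X (r, s))
      = if 1 ≤ s ∧ s ≤ r ∧ r ≤ n then
          Xv r (i + 1) * if r ≤ j.1 then DPoly j r s else if j.1 + 1 = s then 1 else 0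
        else 0 := by
  rw [vectorField, mkDerivation_X]
  by_cases h : 1 ≤ s ∧ s ≤ r ∧ r ≤ n
  · rw [dif_pos (by dsimp only; omega), if_pos h, fieldMatrix_single _ _ (by simp; omega)]
    obtain ⟨t, rfl⟩ : ∃ t, s = t + 1 := ⟨s - 1, by omega⟩
    simp
  · rw [dif_neg (by dsimp only; omega), if_neg h]

lemma sum_Icc_mul_pderiv_X (f : ℕ → Rpoly) (a b t r s : ℕ) :
    ∑ q ∈ Icc a b, f q * pderiv (q, t) (X (r, s) : Rpoly)
      = if (a ≤ r ∧ r ≤ b) ∧ s = t then f r else 0 := by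
  simp only [pderiv_X, Pi.single_apply, Prod.mk.injEq, mul_ite, mul_one, mul_zero, ite_and,
    Finset.sum_ite_eq, Finset.mem_Icc]

lemma sum_Icc_mul_pderiv_X' (f : ℕ → Rpoly) (a b t r s : ℕ) :
    ∑ q ∈ Icc a b, f q * pderiv (t, q) (X (r, s) : Rpoly)
      = if r = t ∧ a ≤ s ∧ s ≤ b then f s else 0 := by
  simp only [pderiv_X, Pi.single_apply, Prod.mk.injEq, mul_ite, mul_one, mul_zero, ite_and,
    Finset.sum_ite_irrel, Finset.sum_const_zero, Finset.sum_ite_eq, Finset.mem_Icc]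

lemma derivation_sum_apply {ι : Type*} (t : Finset ι) (D : ι → Derivation ℂ Rpoly Rpoly)
    (p : Rpoly) : (∑ q ∈ t, D q) p = ∑ q ∈ t, D q p := by
  have h := congrFun (map_sum (Derivation.coeFnAddMonoidHom (R := ℂ) (A := Rpoly) (M := Rpoly))
    D t) p
  rwa [Finset.sum_apply] at h

lemma vectorField_single_self (i : Fin (n + 1)) :
    vectorField (Matrix.single i i 1)
      = ∑ r ∈ Icc (i.1 + 1) n, Xv r (i + 1) • pderiv (r, i.1 + 1)
        - ∑ s ∈ Icc 1 i.1, Xv i s • pderiv (i.1, s) := by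
  refine derivation_ext fun ⟨r, s⟩ => ?_
  rw [vectorField_single_X]
  simp only [Derivation.sub_apply, derivation_sum_apply, Derivation.smul_apply, smul_eq_mul,
    sum_Icc_mul_pderiv_X, sum_Icc_mul_pderiv_X']
  have hi := i.2
  rcases lt_trichotomy r i.1 with h | rfl | h
  · rw [Xv_of_lt (show r + 1 < i.1 + 1 by omega), zero_mul, ite_self, if_neg (by omega),
      if_neg (by omega), sub_zero]
  · rw [if_pos le_rfl, DPoly_self, Xv_succ_self, if_neg (show ¬ ((_ ∧ _) ∧ _) by omega)]
    split_ifs <;> first | omega | simp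
  · rw [if_neg (show ¬ r ≤ i.1 by omega), if_neg (show ¬ (r = i.1 ∧ _) by omega)]
    split_ifs <;> first | omega | simp

lemma vectorField_single_of_lt {i j : Fin (n + 1)} (hij : j < i) :
    vectorField (Matrix.single i j 1)
      = -pderiv (i.1, j.1 + 1) + ∑ r ∈ Icc (i.1 + 1) n, Xv r (i + 1) • pderiv (r, j.1 + 1) := by
  refine derivation_ext fun ⟨r, s⟩ => ?_
  rw [vectorField_single_X]
  simp only [Derivation.add_apply, Derivation.neg_apply, derivation_sum_apply,
    Derivation.smul_apply, smul_eq_mul, sum_Icc_mul_pderiv_X]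
  simp only [pderiv_X, Pi.single_apply, Prod.mk.injEq]
  have hi := i.2
  have hij' : j.1 < i.1 := hij
  rcases lt_trichotomy r i.1 with h | rfl | h
  · rw [Xv_of_lt (show r + 1 < i.1 + 1 by omega), zero_mul, ite_self, if_neg (by omega),
      if_neg (by omega), neg_zero, add_zero]
  · rw [if_neg (show ¬ i.1 ≤ j.1 by omega), Xv_succ_self,
      if_neg (show ¬ ((_ ∧ _) ∧ _) by omega)]
    split_ifs <;> first | omega | simp
  · rw [if_neg (show ¬ r ≤ j.1 by omega), if_neg (show ¬ (r = i.1 ∧ _) by omega)]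
    split_ifs <;> first | omega | simp

lemma vectorField_single_of_gt {i j : Fin (n + 1)} (hij : i < j) :
    vectorField (Matrix.single i j 1)
      = ∑ r ∈ Icc (j.1 + 1) n, Xv r (i + 1) • pderiv (r, j.1 + 1)
        + ∑ s ∈ Icc i.1 j.1, ∑ t ∈ Icc 1 s, (DPoly j s t * Xv s (i + 1)) • pderiv (s, t) := by
  refine derivation_ext fun ⟨r, s⟩ => ?_
  rw [vectorField_single_X]
  simp only [Derivation.add_apply, derivation_sum_apply, Derivation.smul_apply, smul_eq_mul,
    sum_Icc_mul_pderiv_X, sum_Icc_mul_pderiv_X', ite_and (r = _), Finset.sum_ite_eq,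
    Finset.mem_Icc]
  have hi := i.2
  have hj := j.2
  have hij' : i.1 < j.1 := hij
  rcases lt_or_ge r i.1 with h | h
  · rw [Xv_of_lt (show r + 1 < i.1 + 1 by omega), zero_mul, ite_self, if_neg (by omega),
      if_neg (by omega), add_zero]
  · rcases le_or_gt r j.1 with h2 | h2
    · rw [if_pos h2, if_neg (show ¬ ((_ ∧ _) ∧ _) by omega), mul_comm]
      split_ifs <;> first | omega | simp
    · rw [if_neg h2.not_ge, if_neg (show ¬ (i.1 ≤ r ∧ _) by omega)]
      split_ifs <;> first | omega | simp

/-- The diagonal character of the representation. -/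
def weight (n : ℕ) (c : ℂ) (k : ℕ → ℕ) (r : ℕ) : ℂ :=
  c - ∑ s ∈ Icc (r + 1) n, (k (n - s + 1) : ℂ)

lemma weight_sub_weight (c : ℂ) (k : ℕ → ℕ) {i q : ℕ} (hiq : i ≤ q) (hq : q ≤ n) :
    weight n c k q - weight n c k i = ∑ s ∈ Icc (i + 1) q, (k (n + 1 - s) : ℂ) := by
  have h : ∑ s ∈ Icc (i + 1) n, (k (n - s + 1) : ℂ)
      = ∑ s ∈ Icc (i + 1) q, (k (n - s + 1) : ℂ) + ∑ s ∈ Icc (q + 1) n, (k (n - s + 1) : ℂ) := by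
    simp only [← Finset.Ico_succ_right_eq_Icc, Order.succ_eq_add_one]
    exact (Finset.sum_Ico_consecutive _ (by omega) (by omega)).symm
  rw [weight, weight, h]
  ring_nf
  refine Finset.sum_congr rfl fun s hs => ?_
  rw [Finset.mem_Icc] at hs
  rw [show 1 + (n - s) = 1 + n - s by omega]

lemma character_single (w : ℕ → ℂ) (i j : Fin (n + 1)) :
    character (fun r => w r) (Matrix.single i j 1)
      = ∑ q ∈ Icc i.1 j.1, w q • (invEntry n j q * Xv q (i + 1)) := by
  have h (r : Fin (n + 1)) : w r • coordConj (Matrix.single i j 1) r r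
      = (fun q : ℕ => w q • (invEntry n j q * Xv q (i + 1))) r := by
    rw [coordConj_single, mul_comm]
  rw [character, Finset.sum_congr rfl fun q _ => h q,
    Fin.sum_univ_eq_sum_range (fun q : ℕ => w q • (invEntry n j q * Xv q (i + 1)))]
  symm
  refine Finset.sum_subset (fun q hq => ?_) fun q _ hq => ?_
  · simp only [Finset.mem_Icc, Finset.mem_range] at *; omega
  · simp only [Finset.mem_Icc, not_and_or, not_le] at hq
    rcases hq with hq | hq
    · rw [Xv_of_lt (by omega), mul_zero, smul_zero]
    · rw [invEntry_of_lt hq, zero_mul, smul_zero]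

lemma character_single_self (w : ℕ → ℂ) (i : Fin (n + 1)) :
    character (fun r => w r) (Matrix.single i i 1) = C (w i) := by
  rw [character_single, Finset.Icc_self, Finset.sum_singleton, invEntry_self (by omega),
    Xv_succ_self, smul_eq_C_mul]
  ring

lemma character_single_of_lt (w : ℕ → ℂ) {i j : Fin (n + 1)} (hij : j < i) :
    character (fun r => w r) (Matrix.single i j 1) = 0 := by
  rw [character_single, Finset.Icc_eq_empty (by simpa using hij), Finset.sum_empty]

lemma character_single_of_gt (c : ℂ) (k : ℕ → ℕ) {i j : Fin (n + 1)} (hij : i < j) :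
    character (fun r => weight n c k r) (Matrix.single i j 1)
      = -∑ s ∈ Icc (i.1 + 1) j.1, (k (n + 1 - s) : ℂ) • DPoly j s (i + 1) := by
  have hj := j.2
  have hij' : i.1 < j.1 := hij
  have h0 := sum_Icc_invEntry_mul_Xv (n := n) (s := i) (j := j) (t := i) (by omega) le_rfl
    (by omega)
  rw [if_neg hij'.ne'] at h0
  have h1 : ∑ q ∈ Icc i.1 j.1, weight n c k q • (invEntry n j q * Xv q (i + 1))
      = ∑ q ∈ Icc i.1 j.1, ∑ s ∈ Icc (i.1 + 1) q,
          (k (n + 1 - s) : ℂ) • (invEntry n j q * Xv q (i + 1)) := by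
    rw [← sub_zero (∑ q ∈ Icc i.1 j.1, weight n c k q • _), ← smul_zero (weight n c k i), ← h0,
      Finset.smul_sum, ← Finset.sum_sub_distrib]
    refine Finset.sum_congr rfl fun q hq => ?_
    rw [Finset.mem_Icc] at hq
    rw [← sub_smul, weight_sub_weight c k hq.1 (by omega), Finset.sum_smul]
  rw [character_single, h1, Finset.sum_comm' (t' := Icc (i.1 + 1) j.1) (s' := fun s => Icc s j.1)
    (by intro q s; simp only [Finset.mem_Icc]; omega), ← Finset.sum_neg_distrib]
  refine Finset.sum_congr rfl fun s hs => ?_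
  rw [Finset.mem_Icc] at hs
  rw [DPoly_eq_neg_sum (n := n) hs.2 (by omega), smul_neg, neg_neg, Finset.smul_sum]

lemma actionOp_single (c : ℂ) (k : ℕ → ℕ) (i j : Fin (n + 1)) :
    actionOp (fun r => weight n c k r) (Matrix.single i j 1) = ρ n c k (i + 1) (j + 1) := by
  refine LinearMap.ext fun p => ?_
  rw [actionOp, ρ]
  rcases lt_trichotomy j i with h | rfl | h
  · have h' : j.1 < i.1 := h
    rw [if_neg (by omega), if_pos (by omega), vectorField_single_of_lt h,
      character_single_of_lt _ h]
    simp [mulOp, pd, derivation_sum_apply]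
  · rw [if_pos rfl, vectorField_single_self, character_single_self]
    simp [mulOp, pd, derivation_sum_apply, weight, smul_eq_C_mul, sub_mul]
    ring
  · have h' : i.1 < j.1 := h
    rw [if_neg (by omega), if_neg (by omega), vectorField_single_of_gt h,
      character_single_of_gt c k h]
    simp [mulOp, pd, derivation_sum_apply, sub_eq_add_neg, mul_assoc]

end Matching

/-- The operators `ρ_{i,j}` satisfy the `gl(n+1)` commutation relations
`[ρ_{i,j}, ρ_{k,l}] = δ_{j,k} ρ_{i,l} − δ_{l,i} ρ_{k,j}`, i.e. `E_{i,j} ↦ ρ_{i,j}`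
defines a representation of `gl(n+1, ℂ)` on `R`. -/
theorem stmt2 (n : ℕ) (hn : 2 ≤ n) (c : ℂ) (k : ℕ → ℕ) :
    ∀ i ∈ Finset.Icc 1 (n + 1), ∀ j ∈ Finset.Icc 1 (n + 1),
    ∀ k' ∈ Finset.Icc 1 (n + 1), ∀ l ∈ Finset.Icc 1 (n + 1),
      ρ n c k i j * ρ n c k k' l - ρ n c k k' l * ρ n c k i j
        = (if j = k' then ρ n c k i l else 0) - (if l = i then ρ n c k k' j else 0) := by
  intro i hi j hj p hp l hl
  simp only [Finset.mem_Icc] at hi hj hp hl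
  obtain ⟨i, rfl⟩ := Nat.exists_eq_add_of_le' hi.1
  obtain ⟨j, rfl⟩ := Nat.exists_eq_add_of_le' hj.1
  obtain ⟨p, rfl⟩ := Nat.exists_eq_add_of_le' hp.1
  obtain ⟨l, rfl⟩ := Nat.exists_eq_add_of_le' hl.1
  lift i to Fin (n + 1) using by omega
  lift j to Fin (n + 1) using by omega
  lift p to Fin (n + 1) using by omega
  lift l to Fin (n + 1) using by omega
  simp only [← actionOp_single, actionOp_bracket, actionOp_sub, Nat.add_right_cancel_iff,
    Fin.val_inj]
  congr 1
  · split_ifs with h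
    · rw [h, Matrix.single_mul_single_same, one_mul]
    · rw [Matrix.single_mul_single_of_ne _ _ _ _ h, actionOp_zero]
  · split_ifs with h
    · rw [h, Matrix.single_mul_single_same, one_mul]
    · rw [Matrix.single_mul_single_of_ne _ _ _ _ h, actionOp_zero]

end
end

section
/- Let k_1, k_2 ∈ ℕ and consider the eight linear operators on ℂ[x_1,x_2,y]: E₁₂ = x₁∂_{x₂} + y²∂_y − k₂y, E₂₁ = x₂∂_{x₁} − ∂_y, E₁₃ = x₁(x₁∂_{x₁}+x₂∂_{x₂}−k₁) + (x₁+x₂y)(y∂_y−k₂), E₂₃ = x₂(x₁∂_{x₁}+x₂∂_{x₂}−k₁) − (x₁+x₂y)∂_y, E₃₁ = −∂_{x₁}, E₃₂ = −∂_{x₂}, H₁ = x₁∂_{x₁}−x₂∂_{x₂}+2y∂_y−k₂, H₂ = x₁∂_{x₁}+2x₂∂_{x₂}−y∂_y−k₁. Let V be the smallest ℂ-subspace of ℂ[x₁,x₂,y] containing {y^β : 0 ≤ β ≤ k₂} and invariant under all eight operators. Then the set {x₁^{a}x₂^{b}y^{β} : a,b ∈ ℕ, a+b ≤ k₁, 0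 ≤ β ≤ k₂} ∪ {x₁^{a}x₂^{b}(x₁+x₂y)^{m}y^{β} : a,b ∈ ℕ, a+b = k₁, 1 ≤ m ≤ k₂, 0 ≤ β ≤ k₂−m} is a ℂ-basis of V. -/
open MvPolynomial

noncomputable section

/-- The polynomial ring `ℂ[x₁, x₂, y]`, with `x₁ = X 0`, `x₂ = X 1`, `y = X 2`. -/
abbrev R3 : Type := MvPolynomial (Fin 3) ℂ

def pd3 (p : Fin 3) : Module.End ℂ R3 := (MvPolynomial.pderiv p).toLinearMap

def mulOp3 (a : R3) : Module.End ℂ R3 := LinearMap.mulLeft ℂ a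

/-- `E₁₂ = x₁∂_{x₂} + y²∂_y − k₂y`. -/
def E12 (k₂ : ℕ) : Module.End ℂ R3 :=
  mulOp3 (X 0) ∘ₗ pd3 1 + mulOp3 ((X 2) ^ 2) ∘ₗ pd3 2 - mulOp3 ((k₂ : R3) * X 2)

/-- `E₂₁ = x₂∂_{x₁} − ∂_y`. -/
def E21 : Module.End ℂ R3 := mulOp3 (X 1) ∘ₗ pd3 0 - pd3 2

/-- `E₁₃ = x₁(x₁∂_{x₁}+x₂∂_{x₂}−k₁) + (x₁+x₂y)(y∂_y−k₂)`. -/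
def E13 (k₁ k₂ : ℕ) : Module.End ℂ R3 :=
  mulOp3 (X 0) ∘ₗ (mulOp3 (X 0) ∘ₗ pd3 0 + mulOp3 (X 1) ∘ₗ pd3 1 - mulOp3 (k₁ : R3))
    + mulOp3 (X 0 + X 1 * X 2) ∘ₗ (mulOp3 (X 2) ∘ₗ pd3 2 - mulOp3 (k₂ : R3))

/-- `E₂₃ = x₂(x₁∂_{x₁}+x₂∂_{x₂}−k₁) − (x₁+x₂y)∂_y`. -/
def E23 (k₁ : ℕ) : Module.End ℂ R3 :=
  mulOp3 (X 1) ∘ₗ (mulOp3 (X 0) ∘ₗ pd3 0 + mulOp3 (X 1) ∘ₗ pd3 1 - mulOp3 (k₁ : R3))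
    - mulOp3 (X 0 + X 1 * X 2) ∘ₗ pd3 2

/-- `E₃₁ = −∂_{x₁}`. -/
def E31 : Module.End ℂ R3 := - pd3 0

/-- `E₃₂ = −∂_{x₂}`. -/
def E32 : Module.End ℂ R3 := - pd3 1

/-- `H₁ = x₁∂_{x₁} − x₂∂_{x₂} + 2y∂_y − k₂`. -/
def H1 (k₂ : ℕ) : Module.End ℂ R3 :=
  mulOp3 (X 0) ∘ₗ pd3 0 - mulOp3 (X 1) ∘ₗ pd3 1 + mulOp3 (2 * X 2) ∘ₗ pd3 2
    - mulOp3 (k₂ : R3)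

/-- `H₂ = x₁∂_{x₁} + 2x₂∂_{x₂} − y∂_y − k₁`. -/
def H2 (k₁ : ℕ) : Module.End ℂ R3 :=
  mulOp3 (X 0) ∘ₗ pd3 0 + mulOp3 (2 * X 1) ∘ₗ pd3 1 - mulOp3 (X 2) ∘ₗ pd3 2
    - mulOp3 (k₁ : R3)

/-- The eight operators of the projective oscillator representation of `sl(3)`. -/
def ops (k₁ k₂ : ℕ) : Set (Module.End ℂ R3) :=
  {E12 k₂, E21, E13 k₁ k₂, E23 k₁, E31, E32, H1 k₂, H2 k₁}

/-- The claimed basis: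
`{x₁^a x₂^b y^β : a+b ≤ k₁, β ≤ k₂} ∪ {x₁^a x₂^b (x₁+x₂y)^m y^β : a+b = k₁, 1 ≤ m ≤ k₂, β ≤ k₂ − m}`. -/
def basisSet (k₁ k₂ : ℕ) : Set R3 :=
  {f | (∃ a b β : ℕ, a + b ≤ k₁ ∧ β ≤ k₂ ∧ f = X 0 ^ a * X 1 ^ b * X 2 ^ β) ∨
       (∃ a b m β : ℕ, a + b = k₁ ∧ 1 ≤ m ∧ m ≤ k₂ ∧ β ≤ k₂ - m ∧
          f = X 0 ^ a * X 1 ^ b * (X 0 + X 1 * X 2) ^ m * X 2 ^ β)}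

/-- The product `x₁^a x₂^b (x₁ + x₂y)^m y^β`. -/
def oscMonomial (a b m β : ℕ) : R3 :=
  X 0 ^ a * X 1 ^ b * (X 0 + X 1 * X 2) ^ m * X 2 ^ β

section Operators

variable (k₁ k₂ a b m β : ℕ)

theorem pd3_zero_oscMonomial : pd3 0 (oscMonomial a b m β) =
    (a : ℂ) • oscMonomial (a - 1) b m β + (m : ℂ) • oscMonomial a b (m - 1) β := by
  simp [pd3, oscMonomial, pderiv_X, Derivation.leibniz_pow, smul_eq_C_mul]
  ring

theorem pd3_one_oscMonomial : pd3 1 (oscMonomial a b m β) =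
    (b : ℂ) • oscMonomial a (b - 1) m β + (m : ℂ) • oscMonomial a b (m - 1) (β + 1) := by
  simp [pd3, oscMonomial, pderiv_X, Derivation.leibniz_pow, smul_eq_C_mul]
  ring

theorem pd3_two_oscMonomial : pd3 2 (oscMonomial a b m β) =
    (β : ℂ) • oscMonomial a b m (β - 1) + (m : ℂ) • oscMonomial a (b + 1) (m - 1) β := by
  simp [pd3, oscMonomial, pderiv_X, Derivation.leibniz_pow, smul_eq_C_mul]
  ring

theorem E21_oscMonomial : E21 (oscMonomial a b m β) =
    (a : ℂ) • oscMonomial (a - 1) (b + 1) m β - (β : ℂ) • oscMonomial a b m (β - 1) := by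
  simp only [E21, mulOp3, LinearMap.sub_apply, LinearMap.comp_apply, LinearMap.mulLeft_apply,
    pd3_zero_oscMonomial, pd3_two_oscMonomial]
  simp only [oscMonomial, smul_eq_C_mul]
  ring

theorem E12_oscMonomial : E12 k₂ (oscMonomial a b m β) =
    (b : ℂ) • oscMonomial (a + 1) (b - 1) m β
      + ((m : ℂ) + β - k₂) • oscMonomial a b m (β + 1) := by
  simp only [E12, mulOp3, LinearMap.sub_apply, LinearMap.add_apply, LinearMap.comp_apply,
    LinearMap.mulLeft_apply, pd3_one_oscMonomial, pd3_two_oscMonomial]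
  rcases m with _ | m <;> rcases β with _ | β <;>
    simp [oscMonomial, smul_eq_C_mul] <;> ring

theorem E13_oscMonomial : E13 k₁ k₂ (oscMonomial a b m β) =
    ((a : ℂ) + b - k₁) • oscMonomial (a + 1) b m β
      + ((m : ℂ) + β - k₂) • oscMonomial a b (m + 1) β := by
  simp only [E13, mulOp3, LinearMap.sub_apply, LinearMap.add_apply, LinearMap.comp_apply,
    LinearMap.mulLeft_apply, pd3_zero_oscMonomial, pd3_one_oscMonomial, pd3_two_oscMonomial]
  rcases a with _ | a <;> rcases b with _ | b <;> rcases m with _ | m <;> rcases β with _ | β <;>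
    simp [oscMonomial, smul_eq_C_mul] <;> ring

theorem E23_oscMonomial : E23 k₁ (oscMonomial a b m β) =
    ((a : ℂ) + b - k₁) • oscMonomial a (b + 1) m β
      - (β : ℂ) • oscMonomial a b (m + 1) (β - 1) := by
  simp only [E23, mulOp3, LinearMap.sub_apply, LinearMap.add_apply, LinearMap.comp_apply,
    LinearMap.mulLeft_apply, pd3_zero_oscMonomial, pd3_one_oscMonomial, pd3_two_oscMonomial]
  rcases a with _ | a <;> rcases b with _ | b <;> rcases m with _ | m <;>
    simp [oscMonomial, smul_eq_C_mul] <;> ring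

theorem H1_oscMonomial : H1 k₂ (oscMonomial a b m β) =
    ((a : ℂ) - b + m + 2 * β - k₂) • oscMonomial a b m β := by
  simp only [H1, mulOp3, LinearMap.sub_apply, LinearMap.add_apply, LinearMap.comp_apply,
    LinearMap.mulLeft_apply, pd3_zero_oscMonomial, pd3_one_oscMonomial, pd3_two_oscMonomial]
  rcases a with _ | a <;> rcases b with _ | b <;> rcases m with _ | m <;> rcases β with _ | β <;>
    simp [oscMonomial, smul_eq_C_mul, map_ofNat C 2] <;> ring

theorem H2_oscMonomial : H2 k₁ (oscMonomial a b m β) =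
    ((a : ℂ) + 2 * b + m - β - k₁) • oscMonomial a b m β := by
  simp only [H2, mulOp3, LinearMap.sub_apply, LinearMap.add_apply, LinearMap.comp_apply,
    LinearMap.mulLeft_apply, pd3_zero_oscMonomial, pd3_one_oscMonomial, pd3_two_oscMonomial]
  rcases a with _ | a <;> rcases b with _ | b <;> rcases m with _ | m <;> rcases β with _ | β <;>
    simp [oscMonomial, smul_eq_C_mul, map_ofNat C 2] <;> ring

theorem oscMonomial_succ :
    oscMonomial a b (m + 1) β = oscMonomial (a + 1) b m β + oscMonomial a (b + 1) m (β + 1) := by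
  simp only [oscMonomial]
  ring

end Operators

/-- A set of exponents `(a, b, m, β)` indexing `basisSet k₁ k₂` without repetition. -/
def basisIndex (k₁ k₂ : ℕ) : Set (ℕ × ℕ × ℕ × ℕ) :=
  {i | i.1 + i.2.1 ≤ k₁ ∧ i.2.2.1 + i.2.2.2 ≤ k₂ ∧ (i.1 + i.2.1 = k₁ ∨ i.2.2.1 = 0)}

theorem basisSet_eq_image (k₁ k₂ : ℕ) : basisSet k₁ k₂ =
    (fun i : ℕ × ℕ × ℕ × ℕ => oscMonomial i.1 i.2.1 i.2.2.1 i.2.2.2) '' basisIndex k₁ k₂ := by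
  ext f
  constructor
  · rintro (⟨a, b, β, hab, hβ, rfl⟩ | ⟨a, b, m, β, hab, hm, hmk, hβ, rfl⟩)
    · exact ⟨(a, b, 0, β), ⟨hab, by simpa using hβ, Or.inr rfl⟩, by simp [oscMonomial]⟩
    · exact ⟨(a, b, m, β), ⟨hab.le, by dsimp only; omega, Or.inl hab⟩, rfl⟩
  · rintro ⟨⟨a, b, m, β⟩, ⟨hab, hmβ, h⟩, rfl⟩
    dsimp only at hab hmβ h ⊢
    rcases Nat.eq_zero_or_pos m with rfl | hm
    · exact Or.inl ⟨a, b, β, hab, by omega, by simp [oscMonomial]⟩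
    · exact Or.inr ⟨a, b, m, β, by omega, hm, by omega, by omega, rfl⟩

theorem oscMonomial_mem_span {k₁ k₂ a b m β : ℕ} (hab : a + b ≤ k₁) (hmβ : m + β ≤ k₂) :
    oscMonomial a b m β ∈ Submodule.span ℂ (basisSet k₁ k₂) := by
  induction m generalizing a b β with
  | zero =>
    rw [basisSet_eq_image]
    exact Submodule.subset_span ⟨(a, b, 0, β), ⟨hab, hmβ, Or.inr rfl⟩, rfl⟩
  | succ m ih =>
    rcases hab.eq_or_lt with h | h
    · rw [basisSet_eq_image]
      exact Submodule.subset_span ⟨(a, b, m + 1, β), ⟨hab, hmβ, Or.inl h⟩, rfl⟩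
    · rw [oscMonomial_succ]
      exact add_mem (ih (by omega) (by omega)) (ih (by omega) (by omega))

theorem smul_mem_of_ne_zero {K M : Type*} [Field K] [AddCommGroup M] [Module K M]
    {W : Submodule K M} {c : K} {v : M} (h : c ≠ 0 → v ∈ W) : c • v ∈ W := by
  by_cases hc : c = 0
  · simp [hc]
  · exact W.smul_mem c (h hc)

theorem natCast_add_sub_ne_zero {p q k : ℕ} (h : p + q ≤ k) (hc : (p : ℂ) + q - k ≠ 0) :
    p + q + 1 ≤ k := by
  rcases h.eq_or_lt with h | h
  · exact absurd (by rw [← h]; push_cast; ring) hc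
  · exact h

theorem ops_apply_oscMonomial_mem {k₁ k₂ : ℕ} {T : Module.End ℂ R3} (hT : T ∈ ops k₁ k₂)
    {a b m β : ℕ} (hab : a + b ≤ k₁) (hmβ : m + β ≤ k₂) :
    T (oscMonomial a b m β) ∈ Submodule.span ℂ (basisSet k₁ k₂) := by
  rcases hT with rfl | rfl | rfl | rfl | rfl | rfl | rfl | rfl
  · rw [E12_oscMonomial]
    refine add_mem (smul_mem_of_ne_zero fun h => ?_) (smul_mem_of_ne_zero fun h => ?_)
    · have := Nat.cast_ne_zero.mp h
      exact oscMonomial_mem_span (by omega) hmβ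
    · exact oscMonomial_mem_span hab (natCast_add_sub_ne_zero hmβ h)
  · rw [E21_oscMonomial]
    refine sub_mem (smul_mem_of_ne_zero fun h => ?_) (smul_mem_of_ne_zero fun h => ?_)
    · have := Nat.cast_ne_zero.mp h
      exact oscMonomial_mem_span (by omega) hmβ
    · exact oscMonomial_mem_span hab (by omega)
  · rw [E13_oscMonomial]
    refine add_mem (smul_mem_of_ne_zero fun h => ?_) (smul_mem_of_ne_zero fun h => ?_)
    · have := natCast_add_sub_ne_zero hab h
      exact oscMonomial_mem_span (by omega) hmβ
    · have := natCast_add_sub_ne_zero hmβ h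
      exact oscMonomial_mem_span hab (by omega)
  · rw [E23_oscMonomial]
    refine sub_mem (smul_mem_of_ne_zero fun h => ?_) (smul_mem_of_ne_zero fun h => ?_)
    · exact oscMonomial_mem_span (natCast_add_sub_ne_zero hab h) hmβ
    · have := Nat.cast_ne_zero.mp h
      exact oscMonomial_mem_span hab (by omega)
  · rw [E31, LinearMap.neg_apply, pd3_zero_oscMonomial]
    exact neg_mem (add_mem
      (Submodule.smul_mem _ _ (oscMonomial_mem_span (by omega) hmβ))
      (Submodule.smul_mem _ _ (oscMonomial_mem_span hab (by omega))))
  · rw [E32, LinearMap.neg_apply, pd3_one_oscMonomial]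
    refine neg_mem (add_mem
      (Submodule.smul_mem _ _ (oscMonomial_mem_span (by omega) hmβ))
      (smul_mem_of_ne_zero fun h => ?_))
    have := Nat.cast_ne_zero.mp h
    exact oscMonomial_mem_span hab (by omega)
  · rw [H1_oscMonomial]
    exact Submodule.smul_mem _ _ (oscMonomial_mem_span hab hmβ)
  · rw [H2_oscMonomial]
    exact Submodule.smul_mem _ _ (oscMonomial_mem_span hab hmβ)

theorem ops_apply_mem_span {k₁ k₂ : ℕ} {T : Module.End ℂ R3} (hT : T ∈ ops k₁ k₂)
    {v : R3} (hv : v ∈ Submodule.span ℂ (basisSet k₁ k₂)) :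
    T v ∈ Submodule.span ℂ (basisSet k₁ k₂) := by
  suffices h : Submodule.span ℂ (basisSet k₁ k₂) ≤
      (Submodule.span ℂ (basisSet k₁ k₂)).comap T from h hv
  rw [Submodule.span_le]
  nth_rw 1 [basisSet_eq_image]
  rintro _ ⟨i, hi, rfl⟩
  exact ops_apply_oscMonomial_mem hT hi.1 hi.2.1

section Generation

theorem E13_mem_ops (k₁ k₂ : ℕ) : E13 k₁ k₂ ∈ ops k₁ k₂ := by simp [ops]

theorem E23_mem_ops (k₁ k₂ : ℕ) : E23 k₁ ∈ ops k₁ k₂ := by simp [ops]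

variable {k₁ k₂ : ℕ} {V : Submodule ℂ R3}

theorem oscMonomial_pair_mem (hinv : ∀ T ∈ ops k₁ k₂, ∀ v ∈ V, T v ∈ V) {a b : ℕ}
    (hab : a + b < k₁) (h : ∀ β ≤ k₂, oscMonomial a b 0 β ∈ V) {β : ℕ} (hβ : β + 1 ≤ k₂) :
    oscMonomial (a + 1) b 0 β ∈ V ∧ oscMonomial a (b + 1) 0 (β + 1) ∈ V := by
  obtain ⟨c, rfl⟩ := Nat.exists_eq_add_of_lt hab
  obtain ⟨d, rfl⟩ := Nat.exists_eq_add_of_le hβ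
  have h13 := hinv _ (E13_mem_ops _ _) _ (h β (by omega))
  have h23 := hinv _ (E23_mem_ops _ _) _ (h (β + 1) (by omega))
  rw [E13_oscMonomial, oscMonomial_succ] at h13
  rw [E23_oscMonomial, oscMonomial_succ, Nat.add_sub_cancel] at h23
  set A := oscMonomial (a + 1) b 0 β
  set B := oscMonomial a (b + 1) 0 (β + 1)
  have hdet : ((c : ℂ) + 1) * (c + d + β + 3) ≠ 0 := by
    refine mul_ne_zero ?_ ?_ <;> norm_cast
  refine ⟨(V.smul_mem_iff hdet).mp ?_, (V.smul_mem_iff hdet).mp ?_⟩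
  · convert V.sub_mem (V.smul_mem ((d : ℂ) + 1) h23) (V.smul_mem ((c : ℂ) + β + 2) h13) using 1
    push_cast
    module
  · convert V.sub_mem (V.smul_mem ((β : ℂ) + 1) h13) (V.smul_mem ((c : ℂ) + d + 2) h23) using 1
    push_cast
    module

theorem oscMonomial_succ_left_mem (hinv : ∀ T ∈ ops k₁ k₂, ∀ v ∈ V, T v ∈ V) {a b : ℕ}
    (hab : a + b < k₁) (h : ∀ β ≤ k₂, oscMonomial a b 0 β ∈ V) {β : ℕ} (hβ : β ≤ k₂) :
    oscMonomial (a + 1) b 0 β ∈ V := by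
  rcases hβ.eq_or_lt with rfl | hβ
  · have h13 := hinv _ (E13_mem_ops _ _) _ (h β le_rfl)
    rw [E13_oscMonomial, Nat.cast_zero, zero_add, sub_self, zero_smul, add_zero] at h13
    refine (V.smul_mem_iff ?_).mp h13
    rw [sub_ne_zero]
    exact_mod_cast hab.ne
  · exact (oscMonomial_pair_mem hinv hab h hβ).1

theorem oscMonomial_succ_right_mem (hinv : ∀ T ∈ ops k₁ k₂, ∀ v ∈ V, T v ∈ V) {a b : ℕ}
    (hab : a + b < k₁) (h : ∀ β ≤ k₂, oscMonomial a b 0 β ∈ V) {β : ℕ} (hβ : β ≤ k₂) :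
    oscMonomial a (b + 1) 0 β ∈ V := by
  rcases β with _ | β
  · have h23 := hinv _ (E23_mem_ops _ _) _ (h 0 hβ)
    rw [E23_oscMonomial, Nat.cast_zero, zero_smul, sub_zero] at h23
    refine (V.smul_mem_iff ?_).mp h23
    rw [sub_ne_zero]
    exact_mod_cast hab.ne
  · exact (oscMonomial_pair_mem hinv hab h hβ).2

theorem oscMonomial_zero_mem (hcont : ∀ β : ℕ, β ≤ k₂ → (X 2 : R3) ^ β ∈ V)
    (hinv : ∀ T ∈ ops k₁ k₂, ∀ v ∈ V, T v ∈ V) {a b : ℕ} (hab : a + b ≤ k₁) :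
    ∀ β ≤ k₂, oscMonomial a b 0 β ∈ V := by
  induction a generalizing b with
  | zero =>
    induction b with
    | zero => simpa [oscMonomial] using hcont
    | succ b ih =>
      exact fun β hβ => oscMonomial_succ_right_mem hinv (by omega) (ih (by omega)) hβ
  | succ a ih =>
    exact fun β hβ => oscMonomial_succ_left_mem hinv (by omega) (ih (by omega)) hβ

theorem oscMonomial_mem_of_add_eq (hcont : ∀ β : ℕ, β ≤ k₂ → (X 2 : R3) ^ β ∈ V)
    (hinv : ∀ T ∈ ops k₁ k₂, ∀ v ∈ V, T v ∈ V) {a b m β : ℕ} (hab : a + b = k₁)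
    (hmβ : m + β ≤ k₂) : oscMonomial a b m β ∈ V := by
  induction m with
  | zero => exact oscMonomial_zero_mem hcont hinv hab.le β (by omega)
  | succ m ih =>
    have h13 := hinv _ (E13_mem_ops _ _) _ (ih (by omega))
    rw [E13_oscMonomial, ← hab, Nat.cast_add, sub_self, zero_smul, zero_add] at h13
    refine (V.smul_mem_iff ?_).mp h13
    rw [sub_ne_zero]
    exact_mod_cast (by omega : m + β ≠ k₂)

theorem span_basisSet_le (hcont : ∀ β : ℕ, β ≤ k₂ → (X 2 : R3) ^ β ∈ V)
    (hinv : ∀ T ∈ ops k₁ k₂, ∀ v ∈ V, T v ∈ V) :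
    Submodule.span ℂ (basisSet k₁ k₂) ≤ V := by
  rw [Submodule.span_le, basisSet_eq_image]
  rintro _ ⟨⟨a, b, m, β⟩, ⟨hab, hmβ, h⟩, rfl⟩
  dsimp only at hab hmβ h ⊢
  rcases h with h | rfl
  · exact oscMonomial_mem_of_add_eq hcont hinv h hmβ
  · exact oscMonomial_zero_mem hcont hinv hab β (by omega)

end Generation

section Independence

/-- The exponent of `x₁^a x₂^b y^c`. -/
def exponent (a b c : ℕ) : Fin 3 →₀ ℕ :=
  Finsupp.single 0 a + Finsupp.single 1 b + Finsupp.single 2 c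

theorem exponent_inj {a b c a' b' c' : ℕ} :
    exponent a b c = exponent a' b' c' ↔ a = a' ∧ b = b' ∧ c = c' := by
  refine ⟨fun h => ⟨?_, ?_, ?_⟩, by rintro ⟨rfl, rfl, rfl⟩; rfl⟩
  · simpa [exponent] using DFunLike.congr_fun h 0
  · simpa [exponent] using DFunLike.congr_fun h 1
  · simpa [exponent] using DFunLike.congr_fun h 2

theorem monomial_exponent (a b c : ℕ) (r : ℂ) :
    monomial (exponent a b c) r = C r * (X 0 ^ a * X 1 ^ b * X 2 ^ c) := by
  simp only [exponent, X_pow_eq_monomial, monomial_mul, C_mul_monomial, mul_one]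

theorem oscMonomial_eq_sum (a b m β : ℕ) : oscMonomial a b m β =
    ∑ j ∈ Finset.range (m + 1),
      monomial (exponent (a + (m - j)) (b + j) (β + j)) (m.choose j : ℂ) := by
  rw [oscMonomial, add_comm (X 0), add_pow, Finset.mul_sum, Finset.sum_mul]
  refine Finset.sum_congr rfl fun j _ => ?_
  rw [monomial_exponent, map_natCast]
  ring

theorem coeff_oscMonomial (a b m β : ℕ) :
    coeff (exponent (a + m) b β) (oscMonomial a b m β) = 1 := by
  rw [oscMonomial_eq_sum, coeff_sum, Finset.sum_eq_single 0]
  · simp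
  · intro j _ hj
    rw [coeff_monomial, if_neg]
    rw [exponent_inj]
    omega
  · simp

theorem exists_of_coeff_oscMonomial_ne_zero {a b m β p q r : ℕ}
    (h : coeff (exponent p q r) (oscMonomial a b m β) ≠ 0) :
    ∃ j ≤ m, p = a + (m - j) ∧ q = b + j ∧ r = β + j := by
  rw [oscMonomial_eq_sum, coeff_sum] at h
  obtain ⟨j, hj, hne⟩ := Finset.exists_ne_zero_of_sum_ne_zero h
  rw [coeff_monomial] at hne
  obtain ⟨h₁, h₂, h₃⟩ := exponent_inj.mp (of_not_not fun hc => hne (if_neg hc))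
  exact ⟨j, Finset.mem_range_succ_iff.mp hj, h₁.symm, h₂.symm, h₃.symm⟩

theorem linearIndepOn_oscMonomial (k₁ k₂ : ℕ) : LinearIndepOn ℂ
    (fun i : ℕ × ℕ × ℕ × ℕ => oscMonomial i.1 i.2.1 i.2.2.1 i.2.2.2) (basisIndex k₁ k₂) := by
  rw [linearIndepOn_iff]
  intro l hl h0
  by_contra hne
  obtain ⟨i, hi, hmin⟩ := l.support.exists_min_image (fun i => i.2.2.2)
    (Finsupp.support_nonempty_iff.mpr hne)
  refine Finsupp.mem_support_iff.mp hi ?_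
  have hcoeff := congrArg (coeff (exponent (i.1 + i.2.2.1) i.2.1 i.2.2.2)) h0
  rw [Finsupp.linearCombination_apply, Finsupp.sum, coeff_sum, Finset.sum_eq_single_of_mem i hi,
    coeff_smul, coeff_oscMonomial, smul_eq_mul, mul_one, coeff_zero] at hcoeff
  · exact hcoeff
  · intro i' hi' hii'
    rw [coeff_smul, smul_eq_mul]
    refine mul_eq_zero_of_right _ (by_contra fun hc => hii' ?_)
    obtain ⟨j, hj, h₁, h₂, h₃⟩ := exists_of_coeff_oscMonomial_ne_zero hc
    have hle := hmin i' hi'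
    obtain ⟨hab, -, hm⟩ := hl hi
    obtain ⟨hab', -, hm'⟩ := hl hi'
    ext <;> omega

end Independence

/-- Proposition 2.1: if `V` is the smallest subspace of `ℂ[x₁,x₂,y]` containing
`{y^β : β ≤ k₂}` and invariant under the eight operators, then `basisSet k₁ k₂`
is a `ℂ`-basis of `V`. -/
theorem stmt3 (k₁ k₂ : ℕ) (V : Submodule ℂ R3)
    (hcont : ∀ β : ℕ, β ≤ k₂ → (X 2 : R3) ^ β ∈ V)
    (hinv : ∀ T ∈ ops k₁ k₂, ∀ v ∈ V, T v ∈ V)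
    (hmin : ∀ W : Submodule ℂ R3, (∀ β : ℕ, β ≤ k₂ → (X 2 : R3) ^ β ∈ W) →
      (∀ T ∈ ops k₁ k₂, ∀ v ∈ W, T v ∈ W) → V ≤ W) :
    Submodule.span ℂ (basisSet k₁ k₂) = V ∧
      LinearIndependent ℂ (fun v : basisSet k₁ k₂ => (v : R3)) := by
  refine ⟨le_antisymm (span_basisSet_le hcont hinv) (hmin _ (fun β hβ => ?_)
    fun T hT v hv => ops_apply_mem_span hT hv), ?_⟩
  · exact Submodule.subset_span (Or.inl ⟨0, 0, β, by omega, hβ, by simp⟩)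
  · rw [basisSet_eq_image]
    exact (linearIndepOn_oscMonomial k₁ k₂).id_image

end
end

section
/- For i ∈ {1,...,n} let Φ_i denote the derivation of R given by Φ_i = ∑_{1≤t≤s≤n} D_{n,s}(t)·x_{s,i}·∂_{x_{s,t}} (with x_{s,i} = 0 when i > s+1 and x_{s,s+1} = −1). Then for all 1 ≤ t ≤ s ≤ n, i ∈ {1,...,n}, and every tuple Θ = (θ_1,...,θ_{s−t+1}) with entries in {1,...,n}, one has Φ_i(d_{s,t}(Θ)) = D_{n,t}(i)·d_{s,t}(Θ) − d_{n,t}(Θ̃), where Θ̃ is the tuple (θ_1,...,θ_{s−t+1}, i, s+2, s+3, ..., n) if s ≤ n−2, Θ̃ = (θ_1,...,θ_{s−t+1}, i) if s = n−1, and the term d_{n,t}(Θ̃) is replaced by 0 if s = n. -/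
open MvPolynomial Finset

noncomputable section

/-- The derivation `Φ_i = ∑_{1≤t≤s≤n} D_{n,s}(t)·x_{s,i}·∂_{x_{s,t}}` of `R`. -/
def Φop (n i : ℕ) (p : Rpoly) : Rpoly :=
  ∑ s ∈ Finset.Icc 1 n, ∑ t ∈ Finset.Icc 1 s,
    DPoly n s t * Xv s i * MvPolynomial.pderiv (s, t) p

/-- The extended tuple `Θ̃`: `(θ_1,...,θ_{s−t+1}, i, s+2, s+3, ..., n)`
(for `s = n−1` this is `(θ_1,...,θ_{s−t+1}, i)`). -/
def tildeΘ (n s t i : ℕ) (Θ : Fin (s - t + 1) → ℕ) : Fin (n - t + 1) → ℕ :=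
  fun b => if h : b.1 < s - t + 1 then Θ ⟨b.1, h⟩
    else if b.1 = s - t + 1 then i else s + (b.1 - (s - t))

/-- A derivation acts on a product by the Leibniz rule. -/
theorem derivation_prod {ι : Type*} [DecidableEq ι] {S A : Type*} [CommSemiring S]
    [CommSemiring A] [Algebra S A] (D : Derivation S A A) (u : Finset ι) (f : ι → A) :
    D (∏ k ∈ u, f k) = ∑ r ∈ u, ∏ k ∈ u, if k = r then D (f k) else f k := by
  induction u using Finset.induction_on with
  | empty => simp
  | insert a u ha ih =>
    rw [Finset.prod_insert ha, D.leibniz, ih, Finset.sum_insert ha, Finset.prod_insert ha,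
      add_comm]
    congr 1
    · rw [if_pos rfl, smul_eq_mul, mul_comm]
      congr 1
      exact Finset.prod_congr rfl fun k hk => (if_neg (by rintro rfl; exact ha hk)).symm
    · rw [smul_eq_mul, Finset.mul_sum]
      refine Finset.sum_congr rfl fun r hr => ?_
      rw [Finset.prod_insert ha, if_neg (by rintro rfl; exact ha hr)]

/-- A derivation acts on a determinant row by row. -/
theorem derivation_det {ι : Type*} [Fintype ι] [DecidableEq ι] {S A : Type*} [CommRing S]
    [CommRing A] [Algebra S A] (D : Derivation S A A) (M : Matrix ι ι A) :
    D M.det = ∑ r, (M.updateRow r fun b => D (M r b)).det := by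
  rw [← Matrix.det_transpose M, Matrix.det_apply]
  simp_rw [← Matrix.det_transpose (M.updateRow _ _), Matrix.det_apply]
  rw [Finset.sum_comm, map_sum]
  refine Finset.sum_congr rfl fun σ _ => ?_
  rw [Units.smul_def, map_zsmul, derivation_prod, Finset.smul_sum]
  refine Finset.sum_congr rfl fun r _ => ?_
  rw [Units.smul_def]
  congr 1
  refine Finset.prod_congr rfl fun k _ => ?_
  simp only [Matrix.transpose_apply, Matrix.updateRow_apply]
  split_ifs with h
  · rw [h]
  · rfl

/-- Expansion of the determinant of a bordered matrix. -/
theorem det_bordered {A : Type*} [CommRing A] {q : ℕ}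
    (B : Matrix (Fin (q + 2)) (Fin (q + 2)) A) :
    B.det = B (Fin.last _) (Fin.last _) * (B.submatrix Fin.castSucc Fin.castSucc).det -
      ∑ r : Fin (q + 1), B r.castSucc (Fin.last _) *
        ((B.submatrix Fin.castSucc Fin.castSucc).updateRow r
          fun b => B (Fin.last _) b.castSucc).det := by
  rw [Matrix.det_succ_column B (Fin.last _), Fin.sum_univ_castSucc, add_comm, sub_eq_add_neg,
    ← Finset.sum_neg_distrib]
  congr 1
  · have h : (-1 : A) ^ ((Fin.last (q + 1)).val + (Fin.last (q + 1)).val) = 1 :=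
      Even.neg_one_pow ⟨_, rfl⟩
    rw [h, one_mul, Fin.succAbove_last]
  · refine Finset.sum_congr rfl fun r _ => ?_
    have hminor : B.submatrix r.castSucc.succAbove (Fin.last (q + 1)).succAbove =
        ((B.submatrix Fin.castSucc Fin.castSucc).updateRow r
          fun b => B (Fin.last _) b.castSucc).submatrix (Fin.cycleIcc r (Fin.last q)) id := by
      ext a b
      rw [Fin.succAbove_last]
      simp only [Matrix.submatrix_apply, Matrix.updateRow_apply, id]
      rcases lt_or_ge a r with h | h
      · rw [Fin.cycleIcc_of_lt h, if_neg h.ne,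
          Fin.succAbove_of_castSucc_lt _ _ (Fin.castSucc_lt_castSucc_iff.2 h)]
      · rw [Fin.succAbove_of_le_castSucc _ _ (Fin.castSucc_le_castSucc_iff.2 h)]
        rcases (Fin.le_last a).lt_or_eq with h' | rfl
        · have hv : (a + 1 : Fin (q + 1)).val = a.val + 1 :=
            Fin.val_add_one_of_lt h'
          rw [Fin.cycleIcc_of_ge_of_lt h h', if_neg]
          · congr 1
            ext
            simp [hv]
          · intro he
            have := congrArg Fin.val he
            have := Fin.le_def.1 h
            omega
        · rw [Fin.cycleIcc_of_last (Fin.le_last r), if_pos rfl, Fin.succ_last]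
    rw [hminor, Matrix.det_permute, Fin.sign_cycleIcc_of_le (Fin.le_last r)]
    have hs : (-1 : A) ^ ((r.castSucc : Fin (q + 2)).val + (Fin.last (q + 1)).val) *
        (-1) ^ ((Fin.last q).val - r.val) = -1 := by
      rw [← pow_add]
      refine Odd.neg_one_pow ⟨q, ?_⟩
      have := r.is_lt
      simp only [Fin.val_castSucc, Fin.val_last]
      omega
    have hc : ((((-1 : ℤˣ) ^ ((Fin.last q).val - r.val) : ℤˣ) : ℤ) : A) =
        (-1) ^ ((Fin.last q).val - r.val) := by
      push_cast
      rfl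
    rw [hc]
    linear_combination (B r.castSucc (Fin.last _) *
        ((B.submatrix Fin.castSucc Fin.castSucc).updateRow r
          fun b => B (Fin.last _) b.castSucc).det) * hs

/-- Trailing columns that are zero apart from an entry `-1` just above the diagonal can be
removed, provided the last row vanishes there. -/
theorem det_remove_superdiagonal {A : Type*} [CommRing A] {p : ℕ} (Y : ℕ → ℕ → A) (v : ℕ → A)
    (m : ℕ) (hpm : p ≤ m) (hY : ∀ a b, p < b → b ≤ m → a + 1 < b → Y a b = 0)
    (hY' : ∀ a, p ≤ a → a < m → Y a (a + 1) = -1) (hv : ∀ b, p < b → b ≤ m → v b = 0) :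
    (Matrix.of fun a b : Fin (m + 1) => if a.1 = m then v b else Y a b).det =
      (Matrix.of fun a b : Fin (p + 1) => if a.1 = p then v b else Y a b).det := by
  induction m, hpm using Nat.le_induction with
  | base => rfl
  | succ m hpm ih =>
    rw [← ih (fun a b h h' => hY a b h (by omega)) (fun a h h' => hY' a h (by omega))
      (fun b h h' => hv b h (by omega)), Matrix.det_succ_column _ (Fin.last _),
      Finset.sum_eq_single (Fin.last m).castSucc]
    · have hs : (-1 : A) ^ ((Fin.last m).castSucc.val + (Fin.last (m + 1)).val) = -1 :=
        Odd.neg_one_pow ⟨m, by simp; omega⟩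
      rw [hs]
      simp only [Matrix.of_apply, Fin.val_castSucc, Fin.val_last, Fin.succAbove_last]
      rw [if_neg (by omega), hY' m hpm (by omega), neg_mul_neg, one_mul, one_mul]
      congr 1
      ext a b
      simp only [Matrix.submatrix_apply, Matrix.of_apply, Fin.val_castSucc]
      rcases (Fin.le_last a).lt_or_eq with h | rfl
      · rw [Fin.succAbove_of_castSucc_lt _ _ (Fin.castSucc_lt_castSucc_iff.2 h)]
        have : a.val < m := h
        rw [Fin.val_castSucc, if_neg (by omega), if_neg (by omega)]
      · rw [Fin.succAbove_castSucc_self, if_pos (by simp), if_pos (by simp)]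
    · intro a _ ha
      simp only [Matrix.of_apply, Fin.val_last]
      split_ifs with h
      · rw [hv _ (by omega) le_rfl, mul_zero, zero_mul]
      · have : a.val ≠ m := fun h' => ha (Fin.ext h')
        rw [hY _ _ (by omega) le_rfl (by omega), mul_zero, zero_mul]
    · simp

/-- Coefficients of the linear relation among the rows `r, …, n` which annihilates the columns
`r + 1, …, n` of the matrix `(x_{i,j})`. -/
def rowCoeff (n k : ℕ) : Rpoly :=
  if k < n then ∑ j ∈ (Finset.Ioc k n).attach, rowCoeff n j.1 * Xv j.1 (k + 1) else 1
termination_by n - k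
decreasing_by
  have := Finset.mem_Ioc.1 j.2
  omega

theorem rowCoeff_self (n : ℕ) : rowCoeff n n = 1 := by
  rw [rowCoeff, if_neg (lt_irrefl n)]

theorem rowCoeff_of_lt {n k : ℕ} (h : k < n) :
    rowCoeff n k = ∑ j ∈ Finset.Ioc k n, rowCoeff n j * Xv j (k + 1) := by
  rw [rowCoeff, if_pos h,
    Finset.sum_attach (Finset.Ioc k n) fun j => rowCoeff n j * Xv j (k + 1)]

theorem Xv_succ (i : ℕ) : Xv i (i + 1) = -1 := by simp [Xv]

theorem Xv_of_le_s14 {i j : ℕ} (h : j ≤ i) : Xv i j = MvPolynomial.X (i, j) := if_pos h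

theorem Xv_of_lt_s14 {i j : ℕ} (h : i + 1 < j) : Xv i j = 0 := by
  rw [Xv, if_neg (by omega), if_neg (by omega)]

/-- The combination of the rows `r, …, n` with coefficients `rowCoeff n`. -/
def rowComb (n r j : ℕ) : Rpoly := ∑ k ∈ Finset.Icc r n, rowCoeff n k * Xv k j

theorem rowComb_eq_zero {n r j : ℕ} (hr : r < j) (hj : j ≤ n) : rowComb n r j = 0 := by
  obtain ⟨k, rfl⟩ : ∃ k, j = k + 1 := ⟨j - 1, by omega⟩
  have hsub : Finset.Icc k n ⊆ Finset.Icc r n := Finset.Icc_subset_Icc (by omega) le_rfl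
  rw [rowComb, ← Finset.sum_subset hsub, ← Finset.add_sum_Ioc_eq_sum_Icc (by omega), Xv_succ,
    rowCoeff_of_lt (by omega)]
  · ring
  · intro l _ hl'
    rw [Finset.mem_Icc] at *
    rw [Xv_of_lt_s14 (by omega), mul_zero]

/-- Reduction of a minor whose trailing columns are consecutive. -/
theorem dPoly_eq_det_rowComb {n t p : ℕ} (hp : t + p ≤ n) (θ : ℕ → ℕ)
    (hθ : ∀ b, p < b → t + b ≤ n → θ b = t + b) :
    dPoly n t (fun b => θ b) = (Matrix.of fun a b : Fin (p + 1) =>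
      if a.1 = p then rowComb n (t + p) (θ b) else Xv (t + a) (θ b)).det := by
  rw [← det_remove_superdiagonal (fun a b => Xv (t + a) (θ b)) (fun b => rowComb n (t + p) (θ b))
    (n - t) (by omega)]
  · rw [dPoly, ← one_smul Rpoly (Matrix.det _)]
    have key := Matrix.det_updateRow_sum
      (Matrix.of fun a b : Fin (n - t + 1) => Xv (t + a.1) (θ b)) (Fin.last (n - t))
      (fun a => if p ≤ a.1 then rowCoeff n (t + a) else 0)
    simp only [Fin.val_last] at key
    rw [if_pos (by omega), show t + (n - t) = n by omega, rowCoeff_self] at key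
    rw [← key]
    congr 1
    refine Matrix.ext fun a b => ?_
    rw [Matrix.updateRow_apply]
    by_cases h : a = Fin.last (n - t)
    · rw [if_pos h, Matrix.of_apply, if_pos (by rw [h]; rfl), Finset.sum_apply, rowComb]
      simp only [Pi.smul_apply, Matrix.of_apply, smul_eq_mul, ite_mul, zero_mul]
      rw [Fin.sum_univ_eq_sum_range
        (fun a => if p ≤ a then rowCoeff n (t + a) * Xv (t + a) (θ b) else 0),
        ← Finset.sum_filter]
      symm
      refine Finset.sum_bij' (fun k _ => k - t) (fun a _ => t + a) ?_ ?_ ?_ ?_ ?_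
      · simp only [Finset.mem_Icc, Finset.mem_filter, Finset.mem_range]; omega
      · simp only [Finset.mem_Icc, Finset.mem_filter, Finset.mem_range]; omega
      · simp only [Finset.mem_Icc]; omega
      · simp
      · intro k hk
        rw [Finset.mem_Icc] at hk
        rw [show t + (k - t) = k by omega]
    · rw [if_neg h, Matrix.of_apply, Matrix.of_apply, if_neg (by simpa [Fin.ext_iff] using h)]
  · intro a b h h' h''
    rw [hθ b h (by omega), Xv_of_lt_s14 (by omega)]
  · intro a h h'
    rw [hθ (a + 1) (by omega) (by omega)]
    exact Xv_succ _
  · intro b h h'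
    rw [hθ b h (by omega), rowComb_eq_zero (by omega) (by omega)]

theorem DPoly_eq_rowComb {n r : ℕ} (hr : r ≤ n) (j : ℕ) : DPoly n r j = rowComb n r j := by
  have := dPoly_eq_det_rowComb (p := 0) (by omega : r + 0 ≤ n)
    (fun b => if b = 0 then j else r + b) fun b h _ => if_neg (by omega)
  rw [DPoly, this, Matrix.det_fin_one]
  simp

/-- `Φop` as a derivation. -/
def Φder (n i : ℕ) : Derivation ℂ Rpoly Rpoly :=
  ∑ s ∈ Finset.Icc 1 n, ∑ t ∈ Finset.Icc 1 s,
    (DPoly n s t * Xv s i) • MvPolynomial.pderiv (s, t)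

theorem Φder_apply (n i : ℕ) (p : Rpoly) : Φder n i p = Φop n i p := by
  have hsum : ∀ (u : Finset ℕ) (D : ℕ → Derivation ℂ Rpoly Rpoly),
      (∑ k ∈ u, D k) p = ∑ k ∈ u, D k p := fun u D => by
    rw [← Derivation.coeFnAddMonoidHom_apply, map_sum, Finset.sum_apply]
    rfl
  simp only [Φder, Φop, hsum, Derivation.smul_apply, smul_eq_mul]

theorem Φder_Xv {n i s j : ℕ} (hs : 1 ≤ s) (hsn : s ≤ n) (hj : 1 ≤ j) (hjn : j ≤ n) :
    Φder n i (Xv s j) = Xv s i * rowComb n s j := by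
  by_cases h : j ≤ s
  · rw [Φder_apply, Φop, Finset.sum_eq_single s, Finset.sum_eq_single j]
    · rw [Xv_of_le_s14 h, MvPolynomial.pderiv_X_self, mul_one, DPoly_eq_rowComb hsn, mul_comm]
    · intro b _ hb
      rw [Xv_of_le_s14 h, MvPolynomial.pderiv_X_of_ne (by simpa using hb.symm), mul_zero]
    · intro h'
      exact absurd (Finset.mem_Icc.2 ⟨hj, h⟩) h'
    · intro b _ hb
      refine Finset.sum_eq_zero fun c _ => ?_
      rw [Xv_of_le_s14 h, MvPolynomial.pderiv_X_of_ne fun h' => hb (by simpa using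
        (congrArg Prod.fst h').symm), mul_zero]
    · intro h'
      exact absurd (Finset.mem_Icc.2 ⟨hs, hsn⟩) h'
  · rw [rowComb_eq_zero (by omega) hjn, mul_zero, Xv, if_neg h]
    split_ifs
    · rw [map_neg, Derivation.map_one_eq_zero, neg_zero]
    · exact map_zero _

theorem rowComb_split {n r s : ℕ} (hr : r ≤ s + 1) (hs : s ≤ n) (j : ℕ) :
    rowComb n r j = ∑ k ∈ Finset.Icc r s, rowCoeff n k * Xv k j + rowComb n (s + 1) j := by
  rw [rowComb, rowComb, ← Finset.sum_union]
  · congr 1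
    ext k
    simp only [Finset.mem_Icc, Finset.mem_union]
    omega
  · rw [Finset.disjoint_left]
    simp only [Finset.mem_Icc]
    omega

theorem sum_Icc_eq_sum_fin {M : Type*} [AddCommMonoid M] {t s : ℕ} (h : t ≤ s) (f : ℕ → M) :
    ∑ k ∈ Finset.Icc t s, f k = ∑ a : Fin (s - t + 1), f (t + a) := by
  rw [Fin.sum_univ_eq_sum_range fun a => f (t + a), ← Finset.Ico_add_one_right_eq_Icc,
    Finset.sum_Ico_eq_sum_range, show s + 1 - t = s - t + 1 by omega]

/-- Replacing row `r` of the minor on rows `t, …, s` by the combination of the rows `r, …, n`. -/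
theorem det_updateRow_rowComb {n s t : ℕ} (hts : t ≤ s) (hsn : s ≤ n)
    (Θ : Fin (s - t + 1) → ℕ) (r : Fin (s - t + 1)) :
    ((Matrix.of fun a b : Fin (s - t + 1) => Xv (t + a.1) (Θ b)).updateRow r
        fun b => rowComb n (t + r) (Θ b)).det =
      rowCoeff n (t + r) * dPoly s t Θ +
      ((Matrix.of fun a b : Fin (s - t + 1) => Xv (t + a.1) (Θ b)).updateRow r
        fun b => rowComb n (s + 1) (Θ b)).det := by
  have hr := r.is_lt
  have hrow : (fun b => rowComb n (t + r) (Θ b)) =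
      (∑ k : Fin (s - t + 1), (if r ≤ k then rowCoeff n (t + k) else 0) •
        (Matrix.of fun a b : Fin (s - t + 1) => Xv (t + a.1) (Θ b)) k) +
      fun b => rowComb n (s + 1) (Θ b) := by
    ext1 b
    rw [rowComb_split (by omega : t + r.1 ≤ s + 1) hsn, Pi.add_apply, Finset.sum_apply]
    congr 1
    have : ∑ k ∈ Finset.Icc (t + r.1) s, rowCoeff n k * Xv k (Θ b) =
        ∑ k ∈ Finset.Icc t s, if t + r.1 ≤ k then rowCoeff n k * Xv k (Θ b) else 0 := by
      rw [← Finset.sum_filter]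
      refine Finset.sum_congr ?_ fun _ _ => rfl
      ext k
      simp only [Finset.mem_Icc, Finset.mem_filter]
      omega
    rw [this, sum_Icc_eq_sum_fin hts]
    refine Finset.sum_congr rfl fun k _ => ?_
    simp only [Pi.smul_apply, Matrix.of_apply, smul_eq_mul, ite_mul, zero_mul, Fin.le_def,
      Nat.add_le_add_iff_left]
  rw [hrow, Matrix.det_updateRow_add, Matrix.det_updateRow_sum, if_pos le_rfl, smul_eq_mul, dPoly]

/-- The bordered minor attached to the extended tuple. -/
theorem dPoly_tildeΘ {n s t : ℕ} (i : ℕ) (hts : t ≤ s) (hsn : s < n)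
    (Θ : Fin (s - t + 1) → ℕ) :
    dPoly n t (tildeΘ n s t i Θ) = rowComb n (s + 1) i * dPoly s t Θ -
      ∑ r : Fin (s - t + 1), Xv (t + r) i *
        ((Matrix.of fun a b : Fin (s - t + 1) => Xv (t + a.1) (Θ b)).updateRow r
          fun b => rowComb n (s + 1) (Θ b)).det := by
  have key := dPoly_eq_det_rowComb (n := n) (t := t) (p := s - t + 1) (by omega)
    (fun b => if h : b < s - t + 1 then Θ ⟨b, h⟩
      else if b = s - t + 1 then i else s + (b - (s - t)))
    (fun b h h' => by rw [dif_neg (by omega), if_neg (by omega)]; omega)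
  have hsub : ∀ B : Matrix (Fin (s - t + 2)) (Fin (s - t + 2)) Rpoly,
      (∀ a b : Fin (s - t + 1), B a.castSucc b.castSucc = Xv (t + a.1) (Θ b)) →
      B.submatrix Fin.castSucc Fin.castSucc =
        Matrix.of fun a b : Fin (s - t + 1) => Xv (t + a.1) (Θ b) :=
    fun B h => Matrix.ext h
  rw [show t + (s - t + 1) = s + 1 by omega] at key
  refine key.trans ?_
  rw [det_bordered, hsub]
  · simp [dPoly, (Fin.is_lt _).ne, Nat.le_of_lt_succ (Fin.is_lt _)]
  · intro a b
    simp [(Fin.is_lt _).ne, Nat.le_of_lt_succ (Fin.is_lt _)]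

/-- Equations (2.90)-(2.91): for `1 ≤ t ≤ s ≤ n`, `i ∈ {1,...,n}` and any tuple `Θ`
with entries in `{1,...,n}`,
`Φ_i(d_{s,t}(Θ)) = D_{n,t}(i)·d_{s,t}(Θ) − d_{n,t}(Θ̃)`,
where the last term is `0` if `s = n`. -/
theorem stmt14 (n i s t : ℕ) (hn : 2 ≤ n) (hi : 1 ≤ i) (hin : i ≤ n)
    (ht : 1 ≤ t) (hts : t ≤ s) (hsn : s ≤ n)
    (Θ : Fin (s - t + 1) → ℕ) (hΘ : ∀ b, Θ b ∈ Finset.Icc 1 n) :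
    Φop n i (dPoly s t Θ)
      = DPoly n t i * dPoly s t Θ - (if s = n then 0 else dPoly n t (tildeΘ n s t i Θ)) := by
  have hΦ : Φop n i (dPoly s t Θ) =
      (∑ r : Fin (s - t + 1), rowCoeff n (t + r) * Xv (t + r) i) * dPoly s t Θ +
      ∑ r : Fin (s - t + 1), Xv (t + r) i *
        ((Matrix.of fun a b : Fin (s - t + 1) => Xv (t + a.1) (Θ b)).updateRow r
          fun b => rowComb n (s + 1) (Θ b)).det := by
    rw [← Φder_apply, dPoly, derivation_det, Finset.sum_mul, ← Finset.sum_add_distrib]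
    refine Finset.sum_congr rfl fun r _ => ?_
    have hrow : (fun b => Φder n i
        ((Matrix.of fun a b : Fin (s - t + 1) => Xv (t + a.1) (Θ b)) r b)) =
        Xv (t + r) i • fun b => rowComb n (t + r) (Θ b) := by
      ext1 b
      have hb := Finset.mem_Icc.1 (hΘ b)
      have hr := r.is_lt
      exact Φder_Xv (by omega) (by omega) hb.1 hb.2
    rw [hrow, Matrix.det_updateRow_smul, det_updateRow_rowComb hts hsn, dPoly]
    ring
  rw [hΦ, DPoly_eq_rowComb (hts.trans hsn), rowComb_split (by omega : t ≤ s + 1) hsn,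
    sum_Icc_eq_sum_fin hts]
  split_ifs with h
  · subst h
    have hzero : ∀ j, rowComb s (s + 1) j = 0 := fun j => by simp [rowComb]
    have hdet : ∀ r : Fin (s - t + 1),
        ((Matrix.of fun a b : Fin (s - t + 1) => Xv (t + a.1) (Θ b)).updateRow r
          fun _ => 0).det = 0 := fun r =>
      Matrix.det_eq_zero_of_row_eq_zero r fun b => by rw [Matrix.updateRow_self]
    simp only [hzero, hdet, mul_zero, Finset.sum_const_zero, add_zero, sub_zero]
  · rw [dPoly_tildeΘ i hts (lt_of_le_of_ne hsn h)]
    ring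

end
end

section
/- Let n ≥ 3, 2 ≤ i ≤ n−1, and k, r ∈ ℕ. For each integer s with max(0, r−k) ≤ s ≤ r, define m(s) ∈ ℕ^{n−1} by letting m(s)_c be the sum of: s if c = 1, plus (k+s−r) if c = i−1, plus (r−s) if c = i (contributions add when indices coincide, which happens when i = 2), and 0 otherwise. Then ∑_{s=max(0, r−k)}^{r} ∏_{1≤a<b≤n} ((∑_{c=a}^{b−1} m(s)_c) + b − a)/(b − a) = C(n+r−1, n−1) · ∏_{j=1}^{i−1} ( C(k+n−i+j, k) / C(k+j−1, k) ), as an identity in ℚ. -/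
open Finset

/-- The weight `m(s) ∈ ℕ^{n−1}` (1-based): `m(s)_c` is the sum of `s` if `c = 1`,
`k+s−r` if `c = i−1`, and `r−s` if `c = i` (contributions add when indices coincide). -/
def mWt18 (i k r s c : ℕ) : ℕ :=
  (if c = 1 then s else 0) + (if c = i - 1 then k + s - r else 0)
    + (if c = i then r - s else 0)

/-- The rising factorial `x (x + 1) ⋯ (x + m - 1)` of a rational number. -/
def rising (x : ℚ) (m : ℕ) : ℚ := ∏ j ∈ range m, (x + j)

lemma rising_zero (x : ℚ) : rising x 0 = 1 := by simp [rising]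

lemma rising_succ (x : ℚ) (m : ℕ) : rising x (m + 1) = rising x m * (x + m) := by
  simp [rising, prod_range_succ]

lemma rising_add (x : ℚ) (m l : ℕ) :
    rising x (m + l) = rising x m * rising (x + m) l := by
  rw [rising, prod_range_add]
  simp only [rising, Nat.cast_add, add_assoc]

lemma rising_succ_left (x : ℚ) (m : ℕ) : rising x (m + 1) = x * rising (x + 1) m := by
  rw [add_comm m 1, rising_add]
  simp [rising]

lemma rising_shift (x : ℚ) (m : ℕ) : x * rising (x + 1) m = rising x m * (x + m) := by
  rw [← rising_succ_left, rising_succ]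

lemma rising_pos {x : ℚ} (hx : 0 < x) (m : ℕ) : 0 < rising x m :=
  prod_pos fun _ _ => by positivity

lemma rising_div (x y : ℚ) (m : ℕ) :
    rising x m / rising y m = ∏ j ∈ range m, (x + j) / (y + j) := by
  simp [rising, prod_div_distrib]

lemma choose_eq_rising_div (k m : ℕ) :
    (Nat.choose (k + m) k : ℚ) = rising (k + 1) m / rising 1 m := by
  induction m with
  | zero => simp [rising]
  | succ m ih =>
    have h := Nat.add_one_mul_choose_eq (k + m) m
    have h1 : (k + m).choose m = (k + m).choose k := Nat.choose_symm_add.symm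
    have h2 : (k + m + 1).choose (m + 1) = (k + (m + 1)).choose k := by
      rw [add_assoc]; exact Nat.choose_symm_add.symm
    rw [h1, h2] at h
    have h' : ((k : ℚ) + m + 1) * ((k + m).choose k) = (k + (m + 1)).choose k * (m + 1) := by
      exact_mod_cast h
    have hp := rising_pos one_pos m
    rw [ih] at h'
    rw [rising_succ, rising_succ, eq_div_iff (by positivity)]
    field_simp at h'
    linarith

/-- The ratio of the dimension of the `t`-th Pieri constituent to that of the rectangular one,
for a rectangle with `p + 1` rows of length `k` and `sl(p + q + 2)`. -/
def pieriTerm (p q : ℕ) (r k t : ℚ) : ℚ :=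
  rising (r - t + 1) p / rising 1 p * (rising (t + 1) q / rising 1 q) *
    (k + r - 2 * t + p + 1) * rising (k + r - t + p + 2) q * rising (k - t + 1) p /
      rising (k + 1) (p + q + 1)

/-- The telescoping certificate for `pieriTerm` in the direction of `k`. -/
def pieriCert (p q : ℕ) (r k t : ℚ) : ℚ :=
  -(rising (r - t + 1) (p + 1) / rising 1 p * (rising t (q + 1) / rising 1 q) *
    rising (k + r - t + p + 3) q * rising (k - t + 2) p / rising (k + 1) (p + q + 2))

lemma pieriCert_sub (p q : ℕ) (r k t : ℚ) (hk : 0 ≤ k) :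
    pieriCert p q r k (t + 1) - pieriCert p q r k t =
      pieriTerm p q r (k + 1) t - pieriTerm p q r k t := by
  have e1 : rising (r - (t + 1) + 1) (p + 1) = (r - t) * rising (r - t + 1) p := by
    rw [rising_succ_left]; ring_nf
  have e2 := rising_succ (r - t + 1) p
  have e3 := rising_succ (t + 1) q
  have e4 := rising_succ_left t q
  have e5 := rising_succ (k + 1) (p + q + 1)
  have e6 : rising (k + 1 + 1) (p + q + 1) =
      rising (k + 1) (p + q + 1) * (k + 1 + (p + q + 1)) / (k + 1) := by
    rw [eq_div_iff (by positivity)]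
    have := rising_shift (k + 1) (p + q + 1)
    push_cast at this
    linarith
  have hU := rising_shift (k + r - t + p + 2) q
  have hV := rising_shift (k - t + 1) p
  have hW := rising_pos (x := k + 1) (by positivity) (p + q + 1)
  have hp := rising_pos one_pos p
  have hq := rising_pos one_pos q
  have a1 : k + r - (t + 1) + p + 3 = k + r - t + p + 2 := by ring
  have a2 : k - (t + 1) + 2 = k - t + 1 := by ring
  have a3 : k + 1 + r - t + p + 2 = k + r - t + p + 2 + 1 := by ring
  have a4 : k + 1 - t + 1 = k - t + 1 + 1 := by ring
  have a5 : k + r - t + p + 3 = k + r - t + p + 2 + 1 := by ring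
  have a6 : k - t + 2 = k - t + 1 + 1 := by ring
  unfold pieriCert pieriTerm
  rw [a1, a2, a3, a4, a5, a6, e1, e2, e3, e4, e5, e6]
  push_cast
  generalize rising (k + r - t + p + 2 + 1) q = U' at *
  generalize rising (k + r - t + p + 2) q = U at *
  generalize rising (k - t + 1 + 1) p = V' at *
  generalize rising (k - t + 1) p = V at *
  generalize rising (k + 1) (p + q + 1) = W at *
  generalize rising 1 p = C at *
  generalize rising 1 q = D at *
  generalize rising (r - t + 1) p = A at *
  generalize rising (t + 1) q = B at *
  have hUV : (k + r - t + p + 2) * U' * ((k - t + 1) * V') =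
      U * (k + r - t + p + 2 + q) * (V * (k - t + 1 + p)) := by rw [hU, hV]
  have hN : (0 : ℚ) < k + 1 + (p + q + 1) := by positivity
  have hk1 : (0 : ℚ) < k + 1 := by positivity
  field_simp
  linear_combination (-A * B) * hUV

lemma sum_pieriTerm_sub (p q : ℕ) (r k : ℚ) (hk : 0 ≤ k) (T : ℕ) :
    ∑ t ∈ range T, pieriTerm p q r (k + 1) t - ∑ t ∈ range T, pieriTerm p q r k t =
      pieriCert p q r k T := by
  induction T with
  | zero => simp [pieriCert, rising_succ_left 0 q]
  | succ T ih =>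
    rw [sum_range_succ, sum_range_succ]
    have := pieriCert_sub p q r k T hk
    push_cast
    linarith

lemma sum_pieriTerm (p q r k : ℕ) :
    ∑ t ∈ range (min r k + 1), pieriTerm p q r k t =
      rising (r + 1) (p + q + 1) / rising 1 (p + q + 1) := by
  induction k with
  | zero =>
    have hp := rising_pos one_pos p
    have hq := rising_pos one_pos q
    have h1 : rising (r + 1 : ℚ) (p + q + 1) =
        rising (r + 1) p * ((r + p + 1) * rising (r + p + 2) q) := by
      rw [add_assoc, rising_add, rising_succ_left]; ring_nf
    rw [h1]
    simp only [pieriTerm, Nat.min_zero, zero_add, sum_range_one, Nat.cast_zero,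
      sub_zero, mul_zero]
    field_simp
  | succ k ih =>
    rw [← ih]
    have key := sum_pieriTerm_sub p q r k k.cast_nonneg
    rcases le_or_gt r k with h | h
    · rw [min_eq_left h, min_eq_left (by omega)]
      have := key (r + 1)
      have h0 : pieriCert p q r k ((r + 1 : ℕ) : ℚ) = 0 := by
        simp [pieriCert, rising_succ_left _ p]
      push_cast at this h0 ⊢
      linarith
    · rw [min_eq_right h.le, min_eq_right (by omega), sum_range_succ]
      have := key (k + 1)
      have h0 : pieriCert p q r k ((k + 1 : ℕ) : ℚ) +
          pieriTerm p q r ((k + 1 : ℕ) : ℚ) ((k + 1 : ℕ) : ℚ) = 0 := by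
        have hW := rising_pos (x := (k : ℚ) + 1 + 1) (by positivity) (p + q + 1)
        have hp := rising_pos one_pos p
        have hq := rising_pos one_pos q
        simp only [pieriCert, pieriTerm]
        push_cast
        rw [rising_succ, rising_succ_left, rising_succ_left]
        have a1 : (k : ℚ) + r - (k + 1) + p + 3 = k + 1 + r - (k + 1) + p + 2 := by ring
        have a2 : (k : ℚ) - (k + 1) + 2 = k + 1 - (k + 1) + 1 := by ring
        rw [a1, a2]
        have hk : (0 : ℚ) < k + 1 := by positivity
        field_simp
        ring
      push_cast at this h0 ⊢
      linarith

lemma prod_Icc_eq_prod_range (h : ℕ → ℚ) (a m : ℕ) :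
    ∏ b ∈ Icc (a + 1) (a + m), h b = ∏ j ∈ range m, h (a + 1 + j) := by
  induction m with
  | zero => simp
  | succ m ih =>
    rw [← add_assoc, prod_Icc_succ_top (by omega), ih, prod_range_succ]
    congr 2
    omega

/-- The partition `(k + s, k^p, t)` attached to the weight `mWt18`. -/
def pieriPart (p k s t a : ℕ) : ℚ :=
  if a = 1 then k + s else if a ≤ p + 1 then k else if a = p + 2 then t else 0

lemma sum_mWt18 (p k r s t a b : ℕ) (hr : s + t = r) (ht : t ≤ k) (ha : 1 ≤ a) (hab : a < b) :
    ∑ c ∈ Icc a (b - 1), (mWt18 (p + 2) k r s c : ℚ) =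
      pieriPart p k s t a - pieriPart p k s t b := by
  have h1 : k + s - r = k - t := by omega
  have h2 : r - s = t := by omega
  simp only [mWt18, h1, h2, Nat.cast_add, Nat.cast_ite, Nat.cast_zero, sum_add_distrib,
    sum_ite_eq', mem_Icc, pieriPart, Nat.cast_sub ht]
  split_ifs <;> first | (exfalso; omega) | ring

lemma row_top (p q k s t : ℕ) :
    ∏ b ∈ Icc 2 (p + q + 2),
      (pieriPart p k s t 1 - pieriPart p k s t b + (b : ℚ) - (1 : ℕ)) / ((b : ℚ) - (1 : ℕ)) =
    rising (s + 1) p / rising 1 p * ((k + s - t + p + 1) / (p + 1)) *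
      (rising (k + s + p + 2) q / rising (p + 2) q) := by
  have hc : p + q + 2 = 1 + (p + (1 + q)) := by ring
  rw [hc, prod_Icc_eq_prod_range _ 1, prod_range_add, prod_range_add, prod_range_one,
    rising_div, rising_div, mul_assoc]
  congr 1
  · refine prod_congr rfl fun j hj => ?_
    have := mem_range.1 hj
    rw [pieriPart, pieriPart, if_pos rfl, if_neg (by omega), if_pos (by omega)]
    push_cast
    ring_nf
  congr 1
  · rw [pieriPart, pieriPart, if_pos rfl, if_neg (by omega), if_neg (by omega),
      if_pos (by omega)]
    push_cast
    ring_nf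
  · refine prod_congr rfl fun j _ => ?_
    rw [pieriPart, pieriPart, if_pos rfl, if_neg (by omega), if_neg (by omega),
      if_neg (by omega)]
    push_cast
    ring_nf

lemma row_middle (p q k s t a l : ℕ) (hp : p = a + 1 + l) :
    ∏ b ∈ Icc (a + 3) (p + q + 2),
      (pieriPart p k s t (a + 2) - pieriPart p k s t b + (b : ℚ) - (a + 2 : ℕ)) /
        ((b : ℚ) - (a + 2 : ℕ)) =
    (k - t + 1 + l) / (k + 1 + l) *
      (rising (k + l + 1) (q + 1) / rising (l + 1) (q + 1)) := by
  have hc : p + q + 2 = (a + 2) + (l + (1 + q)) := by omega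
  rw [hc, prod_Icc_eq_prod_range _ (a + 2), prod_range_add, prod_range_add, prod_range_one,
    prod_eq_one, one_mul, rising_succ_left, rising_succ_left, mul_div_mul_comm, rising_div,
    ← mul_assoc]
  · congr 1
    · rw [pieriPart, pieriPart, if_neg (by omega), if_pos (by omega), if_neg (by omega),
        if_neg (by omega), if_pos (by omega)]
      have h1 : (0 : ℚ) < k + l + 1 := by positivity
      have h2 : (0 : ℚ) < k + 1 + l := by positivity
      have h3 : (0 : ℚ) < l + 1 := by positivity
      push_cast
      have e1 : (a : ℚ) + 2 + 1 + (l + 0) - (a + 2) = l + 1 := by ring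
      rw [e1]
      field_simp
      ring
    · refine prod_congr rfl fun j _ => ?_
      rw [pieriPart, pieriPart, if_neg (by omega), if_pos (by omega), if_neg (by omega),
        if_neg (by omega), if_neg (by omega)]
      push_cast
      ring_nf
  · intro j hj
    have := mem_range.1 hj
    rw [pieriPart, pieriPart, if_neg (by omega), if_pos (by omega), if_neg (by omega),
      if_pos (by omega)]
    push_cast
    have : (0 : ℚ) < a + 2 + 1 + j - (a + 2) := by
      ring_nf; positivity
    rw [sub_self, zero_add]
    exact div_self this.ne'

lemma row_bottom (p q k s t : ℕ) :
    ∏ b ∈ Icc (p + 3) (p + q + 2),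
      (pieriPart p k s t (p + 2) - pieriPart p k s t b + (b : ℚ) - (p + 2 : ℕ)) /
        ((b : ℚ) - (p + 2 : ℕ)) =
    rising (t + 1) q / rising 1 q := by
  have hc : p + q + 2 = (p + 2) + q := by omega
  rw [hc, prod_Icc_eq_prod_range _ (p + 2), rising_div]
  refine prod_congr rfl fun j _ => ?_
  rw [pieriPart, pieriPart, if_neg (by omega), if_neg (by omega), if_pos (by omega),
    if_neg (by omega), if_neg (by omega), if_neg (by omega)]
  push_cast
  ring_nf

lemma row_below (p q k s t a : ℕ) (ha : p + 2 < a) :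
    ∏ b ∈ Icc (a + 1) (p + q + 2),
      (pieriPart p k s t a - pieriPart p k s t b + (b : ℚ) - (a : ℕ)) / ((b : ℚ) - a) = 1 := by
  refine prod_eq_one fun b hb => ?_
  have hb := mem_Icc.1 hb
  rw [pieriPart, pieriPart, if_neg (by omega), if_neg (by omega), if_neg (by omega),
    if_neg (by omega), if_neg (by omega), if_neg (by omega)]
  have : (a : ℚ) < b := by exact_mod_cast (by omega : a < b)
  rw [sub_self, zero_add]
  exact div_self (sub_ne_zero.2 this.ne')

lemma prod_weyl_eq_pieriTerm_mul (p q k r s t : ℕ) (hr : s + t = r) (ht : t ≤ k) :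
    ∏ a ∈ Icc 1 (p + q + 2), ∏ b ∈ Icc (a + 1) (p + q + 2),
        ((∑ c ∈ Icc a (b - 1), (mWt18 (p + 2) k r s c : ℚ))
          + (b : ℚ) - (a : ℚ)) / ((b : ℚ) - (a : ℚ)) =
      pieriTerm p q r k t * ∏ l ∈ range (p + 1),
        rising (k + l + 1) (q + 1) / rising (l + 1) (q + 1) := by
  have h1 : ∀ a ∈ Icc 1 (p + q + 2), ∏ b ∈ Icc (a + 1) (p + q + 2),
        ((∑ c ∈ Icc a (b - 1), (mWt18 (p + 2) k r s c : ℚ))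
          + (b : ℚ) - (a : ℚ)) / ((b : ℚ) - (a : ℚ)) =
      ∏ b ∈ Icc (a + 1) (p + q + 2),
        (pieriPart p k s t a - pieriPart p k s t b + (b : ℚ) - (a : ℕ)) /
          ((b : ℚ) - (a : ℕ)) := by
    intro a ha
    refine prod_congr rfl fun b hb => ?_
    have ha := mem_Icc.1 ha
    have hb := mem_Icc.1 hb
    rw [sum_mWt18 p k r s t a b hr ht (by omega) (by omega)]
  rw [prod_congr rfl h1]
  have hc : Icc 1 (p + q + 2) = Icc (0 + 1) (0 + (1 + (p + (1 + q)))) := by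
    congr 1; omega
  rw [hc, prod_Icc_eq_prod_range _ 0, prod_range_add, prod_range_add, prod_range_add,
    prod_range_one, prod_range_one]
  have hmid : ∀ x ∈ range p, ∏ b ∈ Icc (0 + 1 + (1 + x) + 1) (p + q + 2),
        (pieriPart p k s t (0 + 1 + (1 + x)) - pieriPart p k s t b + (b : ℚ)
          - (0 + 1 + (1 + x) : ℕ)) / ((b : ℚ) - (0 + 1 + (1 + x) : ℕ)) =
      ((k : ℚ) - t + 1 + (p - 1 - x : ℕ)) / (k + 1 + (p - 1 - x : ℕ)) *
        (rising (k + (p - 1 - x : ℕ) + 1) (q + 1) /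
          rising ((p - 1 - x : ℕ) + 1) (q + 1)) := by
    intro x hx
    have hx := mem_range.1 hx
    have e : 0 + 1 + (1 + x) = x + 2 := by omega
    rw [e]
    exact row_middle p q k s t x (p - 1 - x) (by omega)
  have hbelow : ∀ x ∈ range q, ∏ b ∈ Icc (0 + 1 + (1 + (p + (1 + x))) + 1) (p + q + 2),
        (pieriPart p k s t (0 + 1 + (1 + (p + (1 + x)))) - pieriPart p k s t b + (b : ℚ)
          - (0 + 1 + (1 + (p + (1 + x))) : ℕ)) /
            ((b : ℚ) - (0 + 1 + (1 + (p + (1 + x))) : ℕ)) = 1 :=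
    fun x _ => row_below p q k s t _ (by omega)
  have ebot : 0 + 1 + (1 + (p + 0)) = p + 2 := by omega
  rw [prod_congr rfl hmid, prod_congr rfl hbelow, prod_const_one, mul_one, ebot,
    row_bottom p q k s t]
  have htop := row_top p q k s t
  simp only [add_zero, zero_add] at htop ⊢
  rw [htop, prod_range_reflect (fun l : ℕ => ((k : ℚ) - t + 1 + l) / (k + 1 + l) *
        (rising (k + l + 1) (q + 1) / rising (l + 1) (q + 1))) p,
    prod_mul_distrib, ← rising_div, prod_range_succ, pieriTerm, add_assoc p q 1,
    rising_add (k + 1) p, rising_succ_left, rising_succ_left]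
  have a1 : (r : ℚ) - t + 1 = s + 1 := by rw [← hr]; push_cast; ring
  have a2 : (k : ℚ) + r - 2 * t + p + 1 = k + s - t + p + 1 := by rw [← hr]; push_cast; ring
  have a3 : (k : ℚ) + r - t + p + 2 = k + s + p + 2 := by rw [← hr]; push_cast; ring
  have a4 : (k : ℚ) + 1 + p = k + p + 1 := by ring
  have a5 : (p : ℚ) + 1 + 1 = p + 2 := by ring
  rw [a1, a2, a3, a4, rising_succ_left (p + 1), a5]
  have h2 := rising_pos (x := (k : ℚ) + p + 1 + 1) (by positivity) q
  have h3 : (0 : ℚ) < k + p + 1 := by positivity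
  have h4 := rising_pos (x := (k : ℚ) + 1) (by positivity) p
  have h5 := rising_pos (x := (p : ℚ) + 2) (by positivity) q
  have h6 := rising_pos one_pos p
  have h7 := rising_pos one_pos q
  field_simp

lemma choose_div_choose_eq_rising (k q l : ℕ) :
    (Nat.choose (k + q + (l + 1)) k : ℚ) / (Nat.choose (k + l) k : ℚ) =
      rising (k + l + 1) (q + 1) / rising (l + 1) (q + 1) := by
  have e : k + q + (l + 1) = k + (l + (q + 1)) := by omega
  have a1 : (k : ℚ) + 1 + l = k + l + 1 := by ring
  rw [e, choose_eq_rising_div, choose_eq_rising_div, rising_add, rising_add 1, a1,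
    add_comm (1 : ℚ) l]
  have h4 := rising_pos (x := (k : ℚ) + 1) (by positivity) l
  have h6 := rising_pos one_pos l
  have h7 := rising_pos (x := (l : ℚ) + 1) (by positivity) (q + 1)
  field_simp

/-- Identity (4.35): for `n ≥ 3`, `2 ≤ i ≤ n−1` and `k, r ∈ ℕ`,
`∑_{s=max(0,r−k)}^{r} dim_{sl(n)}(m(s))
  = C(n+r−1, n−1)·∏_{j=1}^{i−1} C(k+n−i+j, k)/C(k+j−1, k)` in `ℚ`,
with the `sl(n)` dimensions given by Weyl's dimension formula. -/
theorem stmt18 (n i k r : ℕ) (hn : 3 ≤ n) (hi2 : 2 ≤ i) (hin : i ≤ n - 1) :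
    ∑ s ∈ Finset.Icc (max 0 (r - k)) r,
      ∏ a ∈ Finset.Icc 1 n, ∏ b ∈ Finset.Icc (a + 1) n,
        ((∑ c ∈ Finset.Icc a (b - 1), (mWt18 i k r s c : ℚ))
          + (b : ℚ) - (a : ℚ)) / ((b : ℚ) - (a : ℚ))
    = (Nat.choose (n + r - 1) (n - 1) : ℚ) *
        ∏ j ∈ Finset.Icc 1 (i - 1),
          (Nat.choose (k + n - i + j) k : ℚ) / (Nat.choose (k + j - 1) k : ℚ) := by
  obtain ⟨p, rfl⟩ : ∃ p, i = p + 2 := ⟨i - 2, by omega⟩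
  obtain ⟨q, rfl⟩ : ∃ q, n = p + q + 2 := ⟨n - p - 2, by omega⟩
  have hprod : ∏ j ∈ Icc 1 (p + 2 - 1),
      (Nat.choose (k + (p + q + 2) - (p + 2) + j) k : ℚ) / (Nat.choose (k + j - 1) k : ℚ) =
      ∏ l ∈ range (p + 1), rising (k + l + 1) (q + 1) / rising (l + 1) (q + 1) := by
    have e : Icc 1 (p + 2 - 1) = Icc (0 + 1) (0 + (p + 1)) := by congr 1; omega
    rw [e, prod_Icc_eq_prod_range]
    refine prod_congr rfl fun l _ => ?_
    have e1 : k + (p + q + 2) - (p + 2) + (0 + 1 + l) = k + q + (l + 1) := by omega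
    have e2 : k + (0 + 1 + l) - 1 = k + l := by omega
    rw [e1, e2, choose_div_choose_eq_rising]
  have hchoose : (Nat.choose (p + q + 2 + r - 1) (p + q + 2 - 1) : ℚ) =
      rising (r + 1) (p + q + 1) / rising 1 (p + q + 1) := by
    have e : p + q + 2 + r - 1 = r + (p + q + 1) := by omega
    rw [e, ← choose_eq_rising_div]
    exact_mod_cast Nat.choose_symm_add.symm
  rw [hprod, hchoose, ← sum_pieriTerm p q r k, sum_mul]
  refine sum_bij' (fun s _ => r - s) (fun t _ => r - t) ?_ ?_ ?_ ?_ ?_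
  · intro s hs
    simp only [mem_Icc, mem_range] at *
    omega
  · intro t ht
    simp only [mem_Icc, mem_range] at *
    omega
  · intro s hs
    simp only [mem_Icc] at *
    omega
  · intro t ht
    simp only [mem_range] at *
    omega
  · intro s hs
    simp only [mem_Icc] at hs
    exact prod_weyl_eq_pieriTerm_mul p q k r s (r - s) (by omega) (by omega)
end
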